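/- arXiv:1211.4811 — 2 statements merged into one kernel-verified Lean document; each statement's English description precedes it below -/
import Mathlib

section
/- For every n ≥ 1, every measurable u : E × X → [0,∞], and every measurable F : X → [0,∞], one has ∫ F(ξ) (∫ u(y,ξ) ξ(dy))^n μ(dξ) = ∑_{k=1}^n ∑_{𝒫 = {P_1,…,P_k} ∈ 𝒯_n^k} ∫_X ∫_{E^k} F(ξ+Δ) · ∏_{l=1}^k u(x_l, ξ+Δ)^{|P_l|} · ĉ((x_1,…,x_k), ξ) λ(dx_1)⋯λ(dx_k) μ(dξ), where Δ = δ_{x_1} + ⋯ + δ_{x_k} and |P_l| is the cardinality of the block P_l. -/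
open MeasureTheory Finset

/-- The compound Papangelou intensity along a tuple:
`ĉ((x_1,…,x_k), ξ) = ∏_{l=1}^k c(x_l, ξ + δ_{x_1} + ⋯ + δ_{x_{l−1}})`. -/
noncomputable def chat {E : Type*} [MeasurableSpace E] (c : E → Measure E → ENNReal)
    {k : ℕ} (x : Fin k → E) (ξ : Measure E) : ENNReal :=
  ∏ l : Fin k, c (x l) (ξ + ∑ j ∈ Finset.univ.filter (fun j => j < l), Measure.dirac (x j))

/-- A fixed enumeration of the blocks of a partition of `{1,…,n}`. -/
noncomputable def blockOf {n : ℕ} (P : Finpartition (Finset.univ : Finset (Fin n)))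
    (l : Fin P.parts.card) : Finset (Fin n) := (P.parts.equivFin.symm l : { B // B ∈ P.parts })

namespace MomentFormula

section

variable {E : Type*} [MeasurableSpace E]

theorem exists_seq_eval_determines_set {s : Set (Measure E)} (hs : MeasurableSet s) :
    ∃ A : ℕ → Set E, (∀ i, MeasurableSet (A i)) ∧
      ∀ ξ ξ' : Measure E, (∀ i, ξ (A i) = ξ' (A i)) → (ξ ∈ s ↔ ξ' ∈ s) := by
  let m : MeasurableSpace (Measure E) :=
    { MeasurableSet' := fun s => ∃ A : ℕ → Set E, (∀ i, MeasurableSet (A i)) ∧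
        ∀ ξ ξ' : Measure E, (∀ i, ξ (A i) = ξ' (A i)) → (ξ ∈ s ↔ ξ' ∈ s)
      measurableSet_empty := ⟨fun _ => ∅, fun _ => .empty, by simp⟩
      measurableSet_compl := by
        rintro s ⟨A, hA, h⟩
        exact ⟨A, hA, fun ξ ξ' e => not_congr (h ξ ξ' e)⟩
      measurableSet_iUnion := by
        intro f hf
        choose A hA h using hf
        refine ⟨fun i => A i.unpair.1 i.unpair.2, fun i => hA _ _, fun ξ ξ' e => ?_⟩
        simp only [Set.mem_iUnion]
        refine exists_congr fun n => h n ξ ξ' fun i => ?_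
        simpa using e (Nat.pair n i) }
  have : Measure.instMeasurableSpace ≤ m := by
    refine iSup₂_le fun t ht => ?_
    rintro _ ⟨v, hv, rfl⟩
    exact ⟨fun _ => t, fun _ => ht, fun ξ ξ' e => by simp [e 0]⟩
  exact this s hs

theorem exists_seq_eval_determines {β : Type*} [MeasurableSpace β]
    [MeasurableSpace.CountablySeparated β] {h : Measure E → β} (hh : Measurable h) :
    ∃ A : ℕ → Set E, (∀ i, MeasurableSet (A i)) ∧
      ∀ ξ ξ' : Measure E, (∀ i, ξ (A i) = ξ' (A i)) → h ξ = h ξ' := by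
  obtain ⟨S, hm⟩ : ∃ S : ℕ → Set β, (∀ n, MeasurableSet (S n)) ∧
      ∀ x ∈ Set.univ, ∀ y ∈ Set.univ, (∀ n, x ∈ S n ↔ y ∈ S n) → x = y :=
    exists_seq_separating β MeasurableSet.empty Set.univ
  choose A hA h' using fun n => exists_seq_eval_determines_set (hh (hm.1 n))
  refine ⟨fun i => A i.unpair.1 i.unpair.2, fun i => hA _ _, fun ξ ξ' e => ?_⟩
  refine hm.2 _ trivial _ trivial fun n => h' n ξ ξ' fun i => ?_
  simpa using e (Nat.pair n i)

theorem exists_seq_rect_determines {α β : Type*} [MeasurableSpace α] [MeasurableSpace β]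
    {D : Set (α × β)} (hD : MeasurableSet D) :
    ∃ (A : ℕ → Set α) (B : ℕ → Set β), (∀ i, MeasurableSet (A i)) ∧ (∀ i, MeasurableSet (B i)) ∧
      ∀ y y' ξ ξ', (∀ i, y ∈ A i ↔ y' ∈ A i) → (∀ i, ξ ∈ B i ↔ ξ' ∈ B i) →
        ((y, ξ) ∈ D ↔ (y', ξ') ∈ D) := by
  let m : MeasurableSpace (α × β) :=
    { MeasurableSet' := fun D => ∃ (A : ℕ → Set α) (B : ℕ → Set β),
        (∀ i, MeasurableSet (A i)) ∧ (∀ i, MeasurableSet (B i)) ∧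
        ∀ y y' ξ ξ', (∀ i, y ∈ A i ↔ y' ∈ A i) → (∀ i, ξ ∈ B i ↔ ξ' ∈ B i) →
        ((y, ξ) ∈ D ↔ (y', ξ') ∈ D)
      measurableSet_empty := ⟨fun _ => ∅, fun _ => ∅, fun _ => .empty, fun _ => .empty, by simp⟩
      measurableSet_compl := by
        rintro s ⟨A, B, hA, hB, h⟩
        exact ⟨A, B, hA, hB, fun y y' ξ ξ' e e' => not_congr (h y y' ξ ξ' e e')⟩
      measurableSet_iUnion := by
        intro f hf
        choose A B hA hB h using hf
        refine ⟨fun i => A i.unpair.1 i.unpair.2, fun i => B i.unpair.1 i.unpair.2,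
          fun i => hA _ _, fun i => hB _ _, fun y y' ξ ξ' e e' => ?_⟩
        simp only [Set.mem_iUnion]
        refine exists_congr fun n => h n y y' ξ ξ' (fun i => ?_) fun i => ?_
        · simpa using e (Nat.pair n i)
        · simpa using e' (Nat.pair n i) }
  have : Prod.instMeasurableSpace ≤ m := by
    refine sup_le ?_ ?_
    · rintro _ ⟨v, hv, rfl⟩
      exact ⟨fun _ => v, fun _ => ∅, fun _ => hv, fun _ => .empty, fun y y' ξ ξ' e _ => by
        simpa using e 0⟩
    · rintro _ ⟨v, hv, rfl⟩
      exact ⟨fun _ => ∅, fun _ => v, fun _ => .empty, fun _ => hv, fun y y' ξ ξ' _ e => by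
        simpa using e 0⟩
  exact this D hD

theorem exists_seq_eval_determines_section {α : Type*} [MeasurableSpace α]
    {D : Set (α × Measure E)} (hD : MeasurableSet D) :
    ∃ A : ℕ → Set E, (∀ i, MeasurableSet (A i)) ∧
      ∀ ξ ξ' : Measure E, (∀ i, ξ (A i) = ξ' (A i)) → ∀ y, (y, ξ) ∈ D ↔ (y, ξ') ∈ D := by
  obtain ⟨_, B, _, hB, h⟩ := exists_seq_rect_determines hD
  choose A hA h' using fun n => exists_seq_eval_determines_set (hB n)
  refine ⟨fun i => A i.unpair.1 i.unpair.2, fun i => hA _ _, fun ξ ξ' e y => ?_⟩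
  refine h _ _ _ _ (fun _ => Iff.rfl) fun n => h' n ξ ξ' fun i => ?_
  simpa using e (Nat.pair n i)

end

section

variable {E : Type*} [MeasurableSpace E]

theorem lintegral_withDensity {α : Type*} [MeasurableSpace α] {ν : Measure α}
    {f g : α → ENNReal} (hf : Measurable f) (hg : Measurable g) :
    ∫⁻ a, g a ∂ν.withDensity f = ∫⁻ a, g a * f a ∂ν := by
  rw [lintegral_withDensity_eq_lintegral_mul _ hf hg]
  simp [mul_comm]

/-- The mean of `w` against the configuration, viewed as a random variable, need not be measurable;
this is a largest measurable minorant of it. -/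
noncomputable def lowerDensity (μ : Measure (Measure E)) [SFinite μ] (w : E × Measure E → ENNReal) :
    Measure E → ENNReal :=
  (exists_measurable_le_forall_setLIntegral_eq μ fun ξ => ∫⁻ y, w (y, ξ) ∂ξ).choose

/-- `C` is the Campbell measure of the point process `μ`. -/
def IsCampbell (μ : Measure (Measure E)) (C : Measure (E × Measure E)) : Prop :=
  ∀ w : E × Measure E → ENNReal, Measurable w →
    ∫⁻ ξ, ∫⁻ y, w (y, ξ) ∂ξ ∂μ = ∫⁻ p, w p ∂C

section lowerDensity

variable {μ : Measure (Measure E)} [SFinite μ] {w : E × Measure E → ENNReal}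

theorem measurable_lowerDensity : Measurable (lowerDensity μ w) :=
  (exists_measurable_le_forall_setLIntegral_eq μ fun ξ => ∫⁻ y, w (y, ξ) ∂ξ).choose_spec.1

theorem lowerDensity_le (ξ : Measure E) : lowerDensity μ w ξ ≤ ∫⁻ y, w (y, ξ) ∂ξ :=
  (exists_measurable_le_forall_setLIntegral_eq μ fun ξ => ∫⁻ y, w (y, ξ) ∂ξ).choose_spec.2.1 ξ

theorem setLIntegral_lowerDensity_eq (s : Set (Measure E)) :
    ∫⁻ ξ in s, lowerDensity μ w ξ ∂μ = ∫⁻ ξ in s, ∫⁻ y, w (y, ξ) ∂ξ ∂μ :=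
  ((exists_measurable_le_forall_setLIntegral_eq μ
    fun ξ => ∫⁻ y, w (y, ξ) ∂ξ).choose_spec.2.2 s).symm

end lowerDensity

theorem IsCampbell.measure_prod {μ : Measure (Measure E)} {C : Measure (E × Measure E)}
    (hC : IsCampbell μ C) {A : Set E} (hA : MeasurableSet A)
    {s : Set (Measure E)} (hs : MeasurableSet s) : C (A ×ˢ s) = ∫⁻ ξ in s, ξ A ∂μ := by
  rw [← lintegral_indicator_one (hA.prod hs), ← hC _ (measurable_one.indicator (hA.prod hs)),
    ← lintegral_indicator hs]
  congr 1 with ξ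
  by_cases h : ξ ∈ s
  · have : ∀ y, (A ×ˢ s).indicator (1 : E × Measure E → ENNReal) (y, ξ) = A.indicator 1 y := by
      intro y; by_cases hy : y ∈ A <;> simp [h, hy]
    simp [h, this, lintegral_indicator_one hA]
  · simp [h]

variable {μ : Measure (Measure E)} [SigmaFinite μ] {C : Measure (E × Measure E)}
  {w : E × Measure E → ENNReal}

theorem IsCampbell.setLIntegral_lowerDensity (hC : IsCampbell μ C) (hw : Measurable w)
    {s : Set (Measure E)} (hs : MeasurableSet s) :
    ∫⁻ ξ in s, lowerDensity μ w ξ ∂μ = ∫⁻ p in Prod.snd ⁻¹' s, w p ∂C := by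
  rw [setLIntegral_lowerDensity_eq, ← lintegral_indicator hs,
    ← lintegral_indicator (measurable_snd hs), ← hC _ (hw.indicator (measurable_snd hs))]
  congr 1 with ξ
  by_cases h : ξ ∈ s <;> simp [h]

theorem IsCampbell.withDensity_lowerDensity (hC : IsCampbell μ C) (hw : Measurable w) :
    μ.withDensity (lowerDensity μ w) = (C.withDensity w).map Prod.snd := by
  ext s hs
  rw [withDensity_apply _ hs, hC.setLIntegral_lowerDensity hw hs,
    Measure.map_apply measurable_snd hs, withDensity_apply _ (measurable_snd hs)]

theorem IsCampbell.lintegral_mul_lowerDensity (hC : IsCampbell μ C) (hw : Measurable w)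
    {F : Measure E → ENNReal} (hF : Measurable F) :
    ∫⁻ ξ, F ξ * lowerDensity μ w ξ ∂μ = ∫⁻ p, F p.2 * w p ∂C := by
  rw [← lintegral_withDensity measurable_lowerDensity hF, hC.withDensity_lowerDensity hw,
    lintegral_map hF measurable_snd]
  exact lintegral_withDensity hw (hF.comp measurable_snd)

theorem IsCampbell.lintegral_lowerDensity (hC : IsCampbell μ C) (hw : Measurable w) :
    ∫⁻ ξ, lowerDensity μ w ξ ∂μ = ∫⁻ p, w p ∂C := by
  simpa using hC.lintegral_mul_lowerDensity hw (F := 1) measurable_one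

theorem IsCampbell.ae_eq_lowerDensity (hC : IsCampbell μ C) (hw : Measurable w)
    {h : Measure E → ENNReal} (hh : Measurable h)
    (H : ∀ s, MeasurableSet s → ∫⁻ ξ in s, h ξ ∂μ = ∫⁻ p in Prod.snd ⁻¹' s, w p ∂C) :
    h =ᵐ[μ] lowerDensity μ w :=
  ae_eq_of_forall_setLIntegral_eq_of_sigmaFinite hh measurable_lowerDensity fun s hs _ => by
    rw [H s hs, hC.setLIntegral_lowerDensity hw hs]

theorem IsCampbell.le_lowerDensity_ae {h : Measure E → ENNReal} (hh : Measurable h)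
    (H : ∀ ξ, h ξ ≤ ∫⁻ y, w (y, ξ) ∂ξ) : h ≤ᵐ[μ] lowerDensity μ w :=
  ae_le_of_forall_setLIntegral_le_of_sigmaFinite hh fun s _ _ => by
    rw [setLIntegral_lowerDensity_eq]
    exact lintegral_mono H

theorem IsCampbell.measure_eq_zero_of_prod_diff (hC : IsCampbell μ C) {D : Set (E × Measure E)}
    (hD : MeasurableSet D)
    (H : ∀ A s, MeasurableSet A → MeasurableSet s → C ((A ×ˢ s) \ D) = C (A ×ˢ s)) :
    C D = 0 := by
  set h := lowerDensity μ (D.indicator 1) with h_def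
  have hw : Measurable (D.indicator (1 : E × Measure E → ENNReal)) := measurable_one.indicator hD
  rw [← lintegral_indicator_one hD, ← hC.lintegral_lowerDensity hw,
    lintegral_eq_zero_iff measurable_lowerDensity]
  obtain ⟨A, hA, hAh⟩ := exists_seq_eval_determines (measurable_lowerDensity (μ := μ)
    (w := D.indicator 1))
  obtain ⟨B, hB, hBD⟩ := exists_seq_eval_determines_section hD
  have key : ∀ K, MeasurableSet K → ∀ᵐ ξ ∂μ, ξ (K ∩ {y | (y, ξ) ∈ D}ᶜ) = ξ K := by
    intro K hK
    have hm : MeasurableSet ((K ×ˢ Set.univ) \ D) := (hK.prod .univ).diff hD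
    have := hC.ae_eq_lowerDensity (w := ((K ×ˢ Set.univ) \ D).indicator 1)
      (measurable_one.indicator hm) (Measure.measurable_coe hK) fun s hs => by
        rw [← hC.measure_prod hK hs, lintegral_indicator_one hm,
          Measure.restrict_apply hm, ← H K s hK hs]
        congr 1; ext ⟨y, ξ⟩; simp; tauto
    filter_upwards [this] with ξ hξ
    refine le_antisymm (measure_mono Set.inter_subset_left) ?_
    rw [hξ]
    refine (lowerDensity_le ξ).trans ?_
    have hm' : MeasurableSet (K ∩ {y | (y, ξ) ∈ D}ᶜ) :=
      hK.inter (measurable_prodMk_right hD).compl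
    rw [← lintegral_indicator_one hm']
    refine lintegral_mono fun y => le_of_eq ?_
    by_cases h1 : y ∈ K <;> by_cases h2 : (y, ξ) ∈ D <;> simp [h1, h2]
  filter_upwards [ae_all_iff.2 fun i => key _ (hA i), ae_all_iff.2 fun i => key _ (hB i)]
    with ξ h1 h2
  set S := {y | (y, ξ) ∈ D} with hS_def
  have hS : MeasurableSet S := measurable_prodMk_right hD
  have e1 : ∀ i, ξ (A i) = ξ.restrict Sᶜ (A i) := fun i => by
    rw [Measure.restrict_apply (hA i), h1]
  have e2 : ∀ i, ξ (B i) = ξ.restrict Sᶜ (B i) := fun i => by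
    rw [Measure.restrict_apply (hB i), h2]
  rw [hAh _ _ e1, Pi.zero_apply, ← nonpos_iff_eq_zero]
  refine (lowerDensity_le _).trans ?_
  have : ∀ y, D.indicator (1 : E × Measure E → ENNReal) (y, ξ.restrict Sᶜ) = S.indicator 1 y := by
    intro y
    have := hBD _ _ e2 y
    by_cases hy : y ∈ S
    · have hy' : (y, ξ.restrict Sᶜ) ∈ D := this.1 hy
      simp [hy, hy']
    · have hy' : (y, ξ.restrict Sᶜ) ∉ D := fun h => hy (this.2 h)
      simp [hy, hy']
  simp only [this]
  rw [lintegral_indicator_one hS, Measure.restrict_apply hS]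
  simp

/-- The part of `E × Measure E` on which the configuration is locally finite near the point,
as witnessed by the sets `A i`. -/
def finRegion (A : ℕ → Set E) : Set (E × Measure E) := ⋃ i, A i ×ˢ {ξ | ξ (A i) < ⊤}

theorem measurableSet_eval_lt_top {A : Set E} (hA : MeasurableSet A) :
    MeasurableSet {ξ : Measure E | ξ A < ⊤} :=
  measurableSet_lt (Measure.measurable_coe hA) measurable_const

theorem measurableSet_finRegion {A : ℕ → Set E} (hA : ∀ i, MeasurableSet (A i)) :
    MeasurableSet (finRegion A) :=
  .iUnion fun i => (hA i).prod (measurableSet_eval_lt_top (hA i))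

theorem exists_maximal_finRegion (C : Measure (E × Measure E)) [SFinite C] :
    ∃ A : ℕ → Set E, (∀ i, MeasurableSet (A i)) ∧
      ∀ B, MeasurableSet B → C ((B ×ˢ {ξ | ξ B < ⊤}) \ finRegion A) = 0 := by
  obtain ⟨D, hD, hDc, h⟩ := Measure.exists_ae_subset_biUnion_countable C
    (C := (fun B : Set E => B ×ˢ {ξ : Measure E | ξ B < ⊤}) '' {B | MeasurableSet B}) (by
      rintro _ ⟨B, hB, rfl⟩
      exact MeasurableSet.prod hB (measurableSet_eval_lt_top hB))
  obtain ⟨T, hT, rfl⟩ := Set.subset_image_iff.1 hD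
  have : ∃ A : ℕ → Set E, (∀ i, MeasurableSet (A i)) ∧
      ⋃₀ ((fun B : Set E => B ×ˢ {ξ : Measure E | ξ B < ⊤}) '' T) ⊆ finRegion A := by
    rcases (((fun B : Set E => B ×ˢ {ξ : Measure E | ξ B < ⊤}) '' T)).eq_empty_or_nonempty
      with h0 | h0
    · exact ⟨fun _ => ∅, fun _ => .empty, by simp [h0]⟩
    · obtain ⟨f, hf⟩ := hDc.exists_eq_range h0
      have hf' : ∀ n, ∃ B ∈ T, B ×ˢ {ξ : Measure E | ξ B < ⊤} = f n := fun n => by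
        have : f n ∈ Set.range f := ⟨n, rfl⟩
        rwa [← hf] at this
      choose A hA hAf using hf'
      refine ⟨A, fun i => hT (hA i), ?_⟩
      rw [hf, Set.sUnion_range]
      exact Set.iUnion_mono fun i => (hAf i).ge
  obtain ⟨A, hA, hsub⟩ := this
  refine ⟨A, hA, fun B hB => ?_⟩
  exact measure_mono_null (Set.sdiff_subset_sdiff_right hsub)
    (ae_le_set.1 (h _ ⟨B, hB, rfl⟩))

theorem IsCampbell.measure_eq_zero_of_disjoint_finRegion (hC : IsCampbell μ C) {A : ℕ → Set E}
    (hA : ∀ B, MeasurableSet B → C ((B ×ˢ {ξ | ξ B < ⊤}) \ finRegion A) = 0)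
    {D : Set (E × Measure E)} (hD : MeasurableSet D) (hDA : Disjoint D (finRegion A))
    (H : ∀ B s, MeasurableSet B → MeasurableSet s → C (B ×ˢ s) = ⊤ → C ((B ×ˢ s) \ D) = ⊤) :
    C D = 0 := by
  refine hC.measure_eq_zero_of_prod_diff hD fun B s hB hs => ?_
  refine le_antisymm (measure_mono Set.sdiff_subset) ?_
  set V := {ξ : Measure E | ξ B < ⊤} with hV
  have hVm : MeasurableSet V := measurableSet_eval_lt_top hB
  have h1 : C (B ×ˢ (s ∩ V)) ≤ C ((B ×ˢ (s ∩ V)) \ D) := by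
    rw [measure_sdiff_null']
    refine measure_mono_null (fun p hp => ?_) (hA B hB)
    exact ⟨⟨hp.1.1, hp.1.2.2⟩, Set.disjoint_left.1 hDA hp.2⟩
  have h2 : C (B ×ˢ (s \ V)) ≤ C ((B ×ˢ (s \ V)) \ D) := by
    have : C (B ×ˢ (s \ V)) = ⊤ * μ (s \ V) := by
      rw [hC.measure_prod hB (hs.diff hVm), ← setLIntegral_const]
      refine setLIntegral_congr_fun (hs.diff hVm) fun ξ hξ => ?_
      simpa [hV] using hξ.2
    rcases eq_or_ne (μ (s \ V)) 0 with h0 | h0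
    · simp [this, h0]
    · rw [H B _ hB (hs.diff hVm) (by rw [this, ENNReal.top_mul h0])]
      exact le_top
  have hm : MeasurableSet (Prod.snd ⁻¹' V : Set (E × Measure E)) := measurable_snd hVm
  rw [← measure_inter_add_sdiff (B ×ˢ s) hm, ← measure_inter_add_sdiff ((B ×ˢ s) \ D) hm]
  convert add_le_add h1 h2 using 3 <;> (ext ⟨y, ξ⟩; simp; tauto)

theorem IsCampbell.measure_eq_zero_of_ne_top (hC : IsCampbell μ C) {A : ℕ → Set E}
    (hA : ∀ B, MeasurableSet B → C ((B ×ˢ {ξ | ξ B < ⊤}) \ finRegion A) = 0)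
    {D : Set (E × Measure E)} (hD : MeasurableSet D) (hDA : Disjoint D (finRegion A))
    (H : C D ≠ ⊤) : C D = 0 := by
  refine hC.measure_eq_zero_of_disjoint_finRegion hA hD hDA fun B s _ _ hT => ?_
  by_contra h
  have : C (B ×ˢ s) ≤ C ((B ×ˢ s) \ D) + C D :=
    (measure_mono (by intro p hp; by_cases p ∈ D <;> simp_all)).trans (measure_union_le _ _)
  rw [hT, top_le_iff, ENNReal.add_eq_top] at this
  tauto

/-- The Campbell measure attached to a Papangelou intensity `c`. -/
noncomputable def campbell (lam : Measure E) (μ : Measure (Measure E))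
    (c : E → Measure E → ENNReal) : Measure (E × Measure E) :=
  ((lam.prod μ).withDensity (Function.uncurry c)).map fun p => (p.1, p.2 + Measure.dirac p.1)

theorem measurable_add_dirac : Measurable fun p : E × Measure E => p.2 + Measure.dirac p.1 :=
  measurable_snd.add (Measure.measurable_dirac.comp measurable_fst)

theorem measurable_prodMk_add_dirac :
    Measurable fun p : E × Measure E => (p.1, p.2 + Measure.dirac p.1) :=
  measurable_fst.prodMk measurable_add_dirac

variable {lam : Measure E} [SigmaFinite lam] {c : E → Measure E → ENNReal}

instance : SFinite (campbell lam μ c) := by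
  unfold campbell; infer_instance

theorem lintegral_campbell (hc : Measurable (Function.uncurry c)) (hw : Measurable w) :
    ∫⁻ p, w p ∂campbell lam μ c
      = ∫⁻ p, w (p.1, p.2 + Measure.dirac p.1) * c p.1 p.2 ∂lam.prod μ := by
  rw [campbell, lintegral_map hw measurable_prodMk_add_dirac]
  exact lintegral_withDensity hc (hw.comp measurable_prodMk_add_dirac)

theorem isCampbell_campbell (hc : Measurable (Function.uncurry c))
    (hGNZ : ∀ w : E → Measure E → ENNReal, Measurable (Function.uncurry w) →
      ∫⁻ ξ, (∫⁻ x, w x ξ ∂ξ) ∂μ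
        = ∫⁻ ξ, ∫⁻ x, w x (ξ + Measure.dirac x) * c x ξ ∂lam ∂μ) :
    IsCampbell μ (campbell lam μ c) := by
  intro w hw
  have hm : Measurable fun p : E × Measure E => w (p.1, p.2 + Measure.dirac p.1) * c p.1 p.2 :=
    (hw.comp measurable_prodMk_add_dirac).mul hc
  rw [lintegral_campbell hc hw, lintegral_prod_symm _ hm.aemeasurable]
  exact hGNZ (fun x ξ => w (x, ξ)) hw

theorem campbell_eq_zero_of_prod_eq_zero (hc : Measurable (Function.uncurry c))
    {A : ℕ → Set E}
    (hA : ∀ B, MeasurableSet B →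
      campbell lam μ c ((B ×ˢ {ξ | ξ B < ⊤}) \ finRegion A) = 0)
    {D : Set (E × Measure E)} (hD : MeasurableSet D) (hDA : Disjoint D (finRegion A))
    (h0 : lam.prod μ D = 0) : campbell lam μ c D = 0 := by
  obtain ⟨B, hB, hBD⟩ := exists_seq_eval_determines_section hD
  have hn : campbell lam μ c (D ∩ finRegion B) = 0 := by
    rw [finRegion, Set.inter_iUnion, measure_iUnion_null_iff]
    refine fun i => measure_mono_null (fun p hp => ?_) (hA _ (hB i))
    exact ⟨hp.2, Set.disjoint_left.1 hDA hp.1⟩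
  have hm : MeasurableSet (D \ finRegion B) := hD.diff (measurableSet_finRegion hB)
  rw [← measure_inter_add_sdiff D (measurableSet_finRegion hB), hn, zero_add,
    ← lintegral_indicator_one hm, lintegral_campbell hc (measurable_one.indicator hm)]
  have : ∀ᵐ p ∂lam.prod μ, p ∉ D := measure_eq_zero_iff_ae_notMem.1 h0
  rw [← lintegral_zero (μ := lam.prod μ)]
  refine lintegral_congr_ae ?_
  filter_upwards [this] with ⟨y, ξ⟩ hp
  have : (y, ξ + Measure.dirac y) ∉ D \ finRegion B := by
    rintro ⟨h1, h2⟩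
    refine hp ((hBD _ _ (fun i => ?_) y).2 h1)
    simp only [finRegion, Set.mem_iUnion, Set.mem_prod, not_exists, not_and,
      Set.mem_ofPred_eq] at h2
    by_cases hy : y ∈ B i
    · have := h2 i hy
      rw [Measure.add_apply, Measure.dirac_apply' _ (hB i)] at this ⊢
      simp [hy] at this ⊢
      simp [this]
    · simp [Measure.dirac_apply' _ (hB i), hy]
  simp [this]

end

section

theorem integrable_of_abs_le_one {α : Type*} [MeasurableSpace α] {ν : Measure α} [IsFiniteMeasure ν]
    {f : α → ℝ} (hf : Measurable f) (h : ∀ x, |f x| ≤ 1) : Integrable f ν :=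
  Integrable.of_bound hf.aestronglyMeasurable 1 (.of_forall h)

theorem abs_indicator_one_le {γ : Type*} (A : Set γ) (y : γ) :
    |A.indicator (1 : γ → ℝ) y| ≤ 1 := by
  by_cases h : y ∈ A <;> simp [h]

theorem abs_integral_le_one {α : Type*} [MeasurableSpace α] {ν : Measure α} [IsFiniteMeasure ν]
    (hν : ν.real Set.univ ≤ 1) {f : α → ℝ} (h : ∀ x, |f x| ≤ 1) : |∫ x, f x ∂ν| ≤ 1 := by
  have := norm_integral_le_of_norm_le_const (μ := ν) (f := f) (C := 1) (.of_forall h)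
  simp only [Real.norm_eq_abs, one_mul] at this
  exact this.trans hν

theorem sq_integral_le_integral_sq {α : Type*} [MeasurableSpace α] {ν : Measure α}
    [IsFiniteMeasure ν] (hν : ν.real Set.univ ≤ 1) {f : α → ℝ} (hf : Measurable f)
    (h : ∀ x, |f x| ≤ 1) : (∫ x, f x ∂ν) ^ 2 ≤ ∫ x, f x ^ 2 ∂ν := by
  set t := ∫ x, f x ∂ν with ht
  have hi := integrable_of_abs_le_one (ν := ν) hf h
  have hi2 : Integrable (fun x => f x ^ 2) ν :=
    integrable_of_abs_le_one (hf.pow_const 2) fun x => by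
      rw [abs_pow]; exact pow_le_one₀ (abs_nonneg _) (h x)
  have h0 : 0 ≤ ∫ x, (f x - t) ^ 2 ∂ν := integral_nonneg fun x => sq_nonneg _
  have : ∫ x, (f x - t) ^ 2 ∂ν = ∫ x, f x ^ 2 ∂ν - 2 * t * t + ν.real Set.univ * t ^ 2 := by
    have e : ∀ x, (f x - t) ^ 2 = f x ^ 2 - 2 * t * f x + t ^ 2 := fun x => by ring
    simp only [e]
    have hd : Integrable (fun x => f x ^ 2 - 2 * t * f x) ν := hi2.sub (hi.const_mul _)
    rw [integral_add hd (integrable_const _), integral_sub hi2 (hi.const_mul _),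
      integral_const_mul, integral_const, smul_eq_mul]
  nlinarith [sq_nonneg t]

section

variable {α β : Type*} [MeasurableSpace α] [MeasurableSpace β]
  {P : Measure α} {Q : Measure β}

theorem prod_real_univ_le_one [SFinite Q] (hP : P.real Set.univ ≤ 1) (hQ : Q.real Set.univ ≤ 1) :
    (P.prod Q).real Set.univ ≤ 1 := by
  rw [← Set.univ_prod_univ, measureReal_prod_prod]
  exact mul_le_one₀ hP measureReal_nonneg hQ

variable [IsFiniteMeasure P] [IsFiniteMeasure Q]

/-- The box norm of `g` controls its correlation with products of functions. -/
theorem integral_mul_pow_four_le (hP : P.real Set.univ ≤ 1) (hQ : Q.real Set.univ ≤ 1)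
    {g : α → β → ℝ} (hg : Measurable (Function.uncurry g)) (hg1 : ∀ y ξ, |g y ξ| ≤ 1)
    {a : α → ℝ} (ha : Measurable a) (ha1 : ∀ y, |a y| ≤ 1)
    {b : β → ℝ} (hb : Measurable b) (hb1 : ∀ ξ, |b ξ| ≤ 1) :
    (∫ p, a p.1 * b p.2 * g p.1 p.2 ∂P.prod Q) ^ 4 ≤
      ∫ z : (α × α) × (β × β),
        (g z.1.1 z.2.1 * g z.1.2 z.2.1) * (g z.1.1 z.2.2 * g z.1.2 z.2.2)
        ∂(P.prod P).prod (Q.prod Q) := by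
  have mul1 : ∀ {s t : ℝ}, |s| ≤ 1 → |t| ≤ 1 → |s * t| ≤ 1 := fun hs ht => by
    rw [abs_mul]; exact mul_le_one₀ hs (abs_nonneg _) ht
  have gm : ∀ {γ : Type _} [MeasurableSpace γ] {u : γ → α} {v : γ → β}, Measurable u →
      Measurable v → Measurable fun z => g (u z) (v z) :=
    fun hu hv => hg.comp (hu.prodMk hv)
  set K : α × α → ℝ := fun z => ∫ ξ, g z.1 ξ * g z.2 ξ ∂Q with hK
  have hm2 : Measurable (Function.uncurry fun (z : α × α) ξ => g z.1 ξ * g z.2 ξ) := by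
    refine Measurable.mul (gm ?_ ?_) (gm ?_ ?_) <;> fun_prop
  have hKm : Measurable K := hm2.stronglyMeasurable.integral_prod_right.measurable
  have hK1 : ∀ z, |K z| ≤ 1 := fun z => abs_integral_le_one hQ fun ξ => mul1 (hg1 _ _) (hg1 _ _)
  have hm1 : Measurable (Function.uncurry fun ξ y => a y * g y ξ) := by
    refine Measurable.mul ?_ (gm ?_ ?_) <;> fun_prop
  set L : β → ℝ := fun ξ => ∫ y, a y * g y ξ ∂P with hL
  have hLm : Measurable L := hm1.stronglyMeasurable.integral_prod_right.measurable
  have hL1 : ∀ z, |L z| ≤ 1 := fun z => abs_integral_le_one hP fun ξ => mul1 (ha1 _) (hg1 _ _)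
  have step1 : (∫ p, a p.1 * b p.2 * g p.1 p.2 ∂P.prod Q) ^ 2 ≤
      ∫ z : α × α, a z.1 * a z.2 * K z ∂P.prod P := by
    have e1 : ∫ p, a p.1 * b p.2 * g p.1 p.2 ∂P.prod Q = ∫ ξ, b ξ * L ξ ∂Q := by
      rw [integral_prod_symm]
      · refine integral_congr_ae (.of_forall fun ξ => ?_)
        simp only [hL]
        rw [← integral_const_mul]
        exact integral_congr_ae (.of_forall fun y => by ring)
      · refine integrable_of_abs_le_one ?_ fun p => mul1 (mul1 (ha1 _) (hb1 _)) (hg1 _ _)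
        refine Measurable.mul ?_ (gm ?_ ?_) <;> fun_prop
    have e2 : ∫ z : α × α, a z.1 * a z.2 * K z ∂P.prod P = ∫ ξ, L ξ ^ 2 ∂Q := by
      have : ∀ z : α × α, a z.1 * a z.2 * K z =
          ∫ ξ, (a z.1 * g z.1 ξ) * (a z.2 * g z.2 ξ) ∂Q := fun z => by
        simp only [hK]
        rw [← integral_const_mul]
        exact integral_congr_ae (.of_forall fun y => by ring)
      simp only [this]
      rw [integral_integral_swap]
      · refine integral_congr_ae (.of_forall fun ξ => ?_)
        simp only [hL]
        rw [integral_prod_mul (fun y => a y * g y ξ) (fun y => a y * g y ξ), sq]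
      · refine integrable_of_abs_le_one ?_ fun p =>
          mul1 (mul1 (ha1 _) (hg1 _ _)) (mul1 (ha1 _) (hg1 _ _))
        refine Measurable.mul (Measurable.mul ?_ (gm ?_ ?_)) (Measurable.mul ?_ (gm ?_ ?_)) <;>
          fun_prop
    rw [e1, e2]
    refine (sq_integral_le_integral_sq hQ (hb.mul hLm) fun ξ => mul1 (hb1 _) (hL1 _)).trans ?_
    refine integral_mono ?_ ?_ fun ξ => ?_
    · exact integrable_of_abs_le_one ((hb.mul hLm).pow_const 2) fun ξ => by
        rw [abs_pow]; exact pow_le_one₀ (abs_nonneg _) (mul1 (hb1 _) (hL1 _))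
    · exact integrable_of_abs_le_one (hLm.pow_const 2) fun ξ => by
        rw [abs_pow]; exact pow_le_one₀ (abs_nonneg _) (hL1 _)
    · refine (mul_pow (b ξ) (L ξ) 2).trans_le (mul_le_of_le_one_left (sq_nonneg _) ?_)
      rw [← sq_abs]; exact pow_le_one₀ (abs_nonneg _) (hb1 ξ)
  have step2 : (∫ z : α × α, a z.1 * a z.2 * K z ∂P.prod P) ^ 2 ≤ ∫ z, K z ^ 2 ∂P.prod P := by
    have hm : Measurable fun z : α × α => a z.1 * a z.2 * K z := by fun_prop
    have h1 : ∀ z : α × α, |a z.1 * a z.2 * K z| ≤ 1 :=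
      fun z => mul1 (mul1 (ha1 _) (ha1 _)) (hK1 _)
    refine (sq_integral_le_integral_sq (prod_real_univ_le_one hP hP) hm h1).trans ?_
    refine integral_mono ?_ ?_ fun z => ?_
    · exact integrable_of_abs_le_one (hm.pow_const 2) fun ξ => by
        rw [abs_pow]; exact pow_le_one₀ (abs_nonneg _) (h1 _)
    · exact integrable_of_abs_le_one (hKm.pow_const 2) fun ξ => by
        rw [abs_pow]; exact pow_le_one₀ (abs_nonneg _) (hK1 _)
    · refine (mul_pow (a z.1 * a z.2) (K z) 2).trans_le
        (mul_le_of_le_one_left (sq_nonneg _) ?_)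
      rw [← sq_abs]; exact pow_le_one₀ (abs_nonneg _) (mul1 (ha1 _) (ha1 _))
  have step3 : ∫ z, K z ^ 2 ∂P.prod P = ∫ z : (α × α) × (β × β),
        (g z.1.1 z.2.1 * g z.1.2 z.2.1) * (g z.1.1 z.2.2 * g z.1.2 z.2.2)
        ∂(P.prod P).prod (Q.prod Q) := by
    rw [integral_prod (fun z : (α × α) × (β × β) =>
      (g z.1.1 z.2.1 * g z.1.2 z.2.1) * (g z.1.1 z.2.2 * g z.1.2 z.2.2))]
    · refine integral_congr_ae (.of_forall fun z => ?_)
      simp only [hK]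
      rw [integral_prod_mul (fun ξ => g z.1 ξ * g z.2 ξ) (fun ξ => g z.1 ξ * g z.2 ξ), sq]
    · refine integrable_of_abs_le_one ?_ fun p =>
          mul1 (mul1 (hg1 _ _) (hg1 _ _)) (mul1 (hg1 _ _) (hg1 _ _))
      refine Measurable.mul (Measurable.mul (gm ?_ ?_) (gm ?_ ?_))
        (Measurable.mul (gm ?_ ?_) (gm ?_ ?_)) <;> fun_prop
  rw [← step3]
  refine le_trans ?_ step2
  rw [show (4 : ℕ) = 2 * 2 from rfl, pow_mul]
  exact pow_le_pow_left₀ (sq_nonneg _) step1 2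

end

/-- The sign of a bit. -/
def bitSign (b : Bool) : ℝ := if b then 1 else -1

theorem abs_bitSign (b : Bool) : |bitSign b| = 1 := by cases b <;> simp [bitSign]

theorem sum_bitSign_eq_zero {I : Type*} [Fintype I] [DecidableEq I] {i j k l : I}
    (hj : j ≠ i) (hk : k ≠ i) (hl : l ≠ i) :
    ∑ χ : I → Bool, bitSign (χ i) * bitSign (χ j) * (bitSign (χ k) * bitSign (χ l)) = 0 := by
  refine Finset.sum_involution (fun χ _ => Function.update χ i (!χ i)) ?_ ?_ ?_ ?_
  · intro χ _
    rw [Function.update_self, Function.update_of_ne hj, Function.update_of_ne hk,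
      Function.update_of_ne hl]
    have : bitSign (!χ i) = - bitSign (χ i) := by cases χ i <;> simp [bitSign]
    rw [this]; ring
  · intro χ _ _ h
    have := congrFun h i
    simp at this
  · simp
  · intro χ _
    simp

theorem exists_halving_of_cells {α β I J : Type*} [MeasurableSpace α] [MeasurableSpace β]
    [Fintype I] [Fintype J] [MeasurableSpace I] [MeasurableSpace J]
    [MeasurableSingletonClass I] [MeasurableSingletonClass J]
    {P : Measure α} {Q : Measure β} [IsFiniteMeasure P] [IsFiniteMeasure Q]
    (hP : P.real Set.univ ≤ 1) (hQ : Q.real Set.univ ≤ 1)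
    {ι : α → I} {σ : β → J} (hι : Measurable ι) (hσ : Measurable σ) {δ : ℝ}
    (hδ : (P.prod P).real {z | ι z.1 = ι z.2} + (Q.prod Q).real {z | σ z.1 = σ z.2} ≤ δ)
    {S : Set (α × β)} (hS : MeasurableSet S) :
    ∃ W : Set (α × β), MeasurableSet W ∧ ∀ A B, MeasurableSet A → MeasurableSet B →
      (2 * (P.prod Q).real ((A ×ˢ B) ∩ S ∩ W) - (P.prod Q).real ((A ×ˢ B) ∩ S)) ^ 4 ≤ δ := by
  classical
  let s : (I × J → Bool) → α → β → ℝ := fun χ y ξ => bitSign (χ (ι y, σ ξ))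
  let o : α → β → ℝ := fun y ξ => S.indicator 1 (y, ξ)
  let g : (I × J → Bool) → α → β → ℝ := fun χ y ξ => o y ξ * s χ y ξ
  have hom : Measurable (Function.uncurry o) := measurable_one.indicator hS
  have ho1 : ∀ y ξ, |o y ξ| ≤ 1 := fun y ξ => by
    by_cases h : (y, ξ) ∈ S <;> simp [o, h]
  have hsm : ∀ χ, Measurable (Function.uncurry (s χ)) := fun χ =>
    (measurable_of_finite fun q : I × J => bitSign (χ q)).comp
      ((hι.comp measurable_fst).prodMk (hσ.comp measurable_snd))
  have hgm : ∀ χ, Measurable (Function.uncurry (g χ)) := fun χ => hom.mul (hsm χ)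
  have hg1 : ∀ χ y ξ, |g χ y ξ| ≤ 1 := fun χ y ξ => by
    simpa [g, s, abs_mul, abs_bitSign] using ho1 y ξ
  let G : (I × J → Bool) → (α × α) × (β × β) → ℝ := fun χ z =>
    (g χ z.1.1 z.2.1 * g χ z.1.2 z.2.1) * (g χ z.1.1 z.2.2 * g χ z.1.2 z.2.2)
  have hGm : ∀ χ, Measurable (G χ) := fun χ => by
    have gm : ∀ {u : (α × α) × (β × β) → α} {v : (α × α) × (β × β) → β}, Measurable u →
        Measurable v → Measurable fun z => g χ (u z) (v z) :=
      fun hu hv => (hgm χ).comp (hu.prodMk hv)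
    refine Measurable.mul (Measurable.mul (gm ?_ ?_) (gm ?_ ?_))
      (Measurable.mul (gm ?_ ?_) (gm ?_ ?_)) <;> fun_prop
  have hG1 : ∀ χ z, |G χ z| ≤ 1 := fun χ z => by
    simp only [G, abs_mul]
    have h := fun y ξ => hg1 χ y ξ
    exact mul_le_one₀ (mul_le_one₀ (h _ _) (abs_nonneg _) (h _ _)) (by positivity)
      (mul_le_one₀ (h _ _) (abs_nonneg _) (h _ _))
  set N := (P.prod P).prod (Q.prod Q) with hN
  have hGi : ∀ χ, Integrable (G χ) N := fun χ => integrable_of_abs_le_one (hGm χ) (hG1 χ)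
  let V1 : Set (α × α) := {z | ι z.1 = ι z.2}
  let V2 : Set (β × β) := {z | σ z.1 = σ z.2}
  have hV1 : MeasurableSet V1 :=
    measurableSet_eq_fun (hι.comp measurable_fst) (hι.comp measurable_snd)
  have hV2 : MeasurableSet V2 :=
    measurableSet_eq_fun (hσ.comp measurable_fst) (hσ.comp measurable_snd)
  let V : Set ((α × α) × (β × β)) := V1 ×ˢ Set.univ ∪ Set.univ ×ˢ V2
  have hV : MeasurableSet V := (hV1.prod .univ).union (.prod .univ hV2)
  have hVδ : N.real V ≤ δ := by
    refine le_trans ?_ hδ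
    refine (measureReal_union_le _ _).trans (add_le_add ?_ ?_)
    · rw [hN, measureReal_prod_prod]
      exact mul_le_of_le_one_right measureReal_nonneg (prod_real_univ_le_one hQ hQ)
    · rw [hN, measureReal_prod_prod]
      exact mul_le_of_le_one_left measureReal_nonneg (prod_real_univ_le_one hP hP)
  have hsum : ∑ χ, ∫ z, G χ z ∂N ≤ ∑ _χ : I × J → Bool, δ := by
    rw [← integral_finsetSum _ fun χ _ => hGi χ]
    have hle : ∀ z, ∑ χ, G χ z ≤ V.indicator (fun _ => (Fintype.card (I × J → Bool) : ℝ)) z := by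
      intro z
      by_cases hz : z ∈ V
      · simp only [hz, Set.indicator_of_mem]
        calc ∑ χ, G χ z ≤ ∑ _χ : I × J → Bool, (1 : ℝ) :=
              Finset.sum_le_sum fun χ _ => (le_abs_self _).trans (hG1 χ z)
          _ = _ := by simp
      · rw [Set.indicator_of_notMem hz]
        simp only [V, V1, V2, Set.mem_union, Set.mem_prod, Set.mem_ofPred_eq, Set.mem_univ,
          and_true, true_and, not_or] at hz
        have : ∀ χ, G χ z = (o z.1.1 z.2.1 * o z.1.2 z.2.1 * (o z.1.1 z.2.2 * o z.1.2 z.2.2)) *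
            (bitSign (χ (ι z.1.1, σ z.2.1)) * bitSign (χ (ι z.1.2, σ z.2.1)) *
              (bitSign (χ (ι z.1.1, σ z.2.2)) * bitSign (χ (ι z.1.2, σ z.2.2)))) := fun χ => by
          simp only [G, g, s]; ring
        simp only [this]
        rw [← Finset.mul_sum, sum_bitSign_eq_zero, mul_zero]
        · intro h; exact hz.1 (Prod.ext_iff.1 h).1.symm
        · intro h; exact hz.2 (Prod.ext_iff.1 h).2.symm
        · intro h; exact hz.1 (Prod.ext_iff.1 h).1.symm
    calc ∫ z, ∑ χ, G χ z ∂N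
        ≤ ∫ z, V.indicator (fun _ => (Fintype.card (I × J → Bool) : ℝ)) z ∂N :=
          integral_mono (integrable_finsetSum _ fun χ _ => hGi χ)
            ((integrable_const _).indicator hV) hle
      _ = N.real V * Fintype.card (I × J → Bool) := by
          rw [integral_indicator hV, setIntegral_const, smul_eq_mul]
      _ ≤ _ := by
          rw [Finset.sum_const, nsmul_eq_mul, mul_comm, Finset.card_univ]
          exact mul_le_mul_of_nonneg_left hVδ (by positivity)
  obtain ⟨χ, -, hχ⟩ := Finset.exists_le_of_sum_le Finset.univ_nonempty hsum
  let W : Set (α × β) := {p | χ (ι p.1, σ p.2) = true}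
  have hW : MeasurableSet W :=
    (measurable_of_finite (fun q : I × J => χ q) |>.comp
      ((hι.comp measurable_fst).prodMk (hσ.comp measurable_snd))) (measurableSet_singleton true)
  refine ⟨W, hW, fun A B hA hB => ?_⟩
  have hkey := integral_mul_pow_four_le hP hQ (hgm χ) (hg1 χ) (measurable_one.indicator hA)
    (abs_indicator_one_le A) (measurable_one.indicator hB) (abs_indicator_one_le B)
  refine le_trans (le_of_eq ?_) (hkey.trans hχ)
  congr 1
  have hR : MeasurableSet ((A ×ˢ B) ∩ S) := (hA.prod hB).inter hS
  have : ∀ p : α × β, A.indicator 1 p.1 * B.indicator 1 p.2 * g χ p.1 p.2 =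
      2 * ((A ×ˢ B) ∩ S ∩ W).indicator 1 p - ((A ×ˢ B) ∩ S).indicator (1 : α × β → ℝ) p := by
    rintro ⟨y, ξ⟩
    by_cases h1 : y ∈ A <;> by_cases h2 : ξ ∈ B <;> by_cases h3 : (y, ξ) ∈ S <;>
      by_cases h4 : χ (ι y, σ ξ) <;> simp [h1, h2, h3, h4, g, s, o, W, bitSign] <;> norm_num
  simp only [this]
  rw [integral_sub, integral_const_mul, integral_indicator_one (hR.inter hW),
    integral_indicator_one hR]
  · exact (integrable_of_abs_le_one (measurable_one.indicator (hR.inter hW))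
      (abs_indicator_one_le _)).const_mul 2
  · exact integrable_of_abs_le_one (measurable_one.indicator hR) (abs_indicator_one_le _)

end

section

section sparse

variable {α β : Type*} [MeasurableSpace α] [MeasurableSpace β]
  {P : Measure α} {Q : Measure β} [IsFiniteMeasure P] [IsFiniteMeasure Q]

theorem tendsto_measureReal_agree {φ : α → ℕ → Prop} (hφ : Measurable φ)
    (h0 : (P.prod P) {z | φ z.1 = φ z.2} = 0) :
    Filter.Tendsto (fun N : ℕ => (P.prod P).real
      {z | (fun i : Fin N => φ z.1 i) = fun i : Fin N => φ z.2 i}) Filter.atTop (nhds 0) := by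
  have hm : ∀ N : ℕ, MeasurableSet
      {z : α × α | (fun i : Fin N => φ z.1 i) = fun i : Fin N => φ z.2 i} := fun N => by
    refine measurableSet_eq_fun ?_ ?_ <;>
      exact measurable_pi_lambda _ fun i => (measurable_pi_apply _).comp (hφ.comp (by fun_prop))
  have hanti : Antitone fun N : ℕ =>
      {z : α × α | (fun i : Fin N => φ z.1 i) = fun i : Fin N => φ z.2 i} := by
    intro N N' h z hz
    funext i
    exact congrFun hz ⟨i, i.2.trans_le h⟩
  have hI : ⋂ N : ℕ, {z : α × α | (fun i : Fin N => φ z.1 i) = fun i : Fin N => φ z.2 i} =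
      {z | φ z.1 = φ z.2} := by
    ext z
    simp only [Set.mem_iInter, Set.mem_ofPred_eq]
    refine ⟨fun h => funext fun i => congrFun (h (i + 1)) ⟨i, by omega⟩, fun h N => by rw [h]⟩
  have := tendsto_measure_iInter_atTop (μ := P.prod P) (fun N => (hm N).nullMeasurableSet) hanti
    ⟨0, measure_ne_top _ _⟩
  rw [hI, h0] at this
  exact (ENNReal.tendsto_toReal ENNReal.zero_ne_top).comp this

theorem exists_halving (hP : P.real Set.univ ≤ 1) (hQ : Q.real Set.univ ≤ 1)
    {φ : α → ℕ → Prop} {ψ : β → ℕ → Prop} (hφ : Measurable φ) (hψ : Measurable ψ)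
    (hφ0 : (P.prod P) {z | φ z.1 = φ z.2} = 0) (hψ0 : (Q.prod Q) {z | ψ z.1 = ψ z.2} = 0)
    {S : Set (α × β)} (hS : MeasurableSet S) {ε : ℝ} (hε : 0 < ε) :
    ∃ W : Set (α × β), MeasurableSet W ∧ ∀ A B, MeasurableSet A → MeasurableSet B →
      |2 * (P.prod Q).real ((A ×ˢ B) ∩ S ∩ W) - (P.prod Q).real ((A ×ˢ B) ∩ S)| ≤ ε := by
  have ht := (tendsto_measureReal_agree hφ hφ0).add (tendsto_measureReal_agree hψ hψ0)
  rw [add_zero] at ht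
  obtain ⟨N, hN⟩ := (ht.eventually (ge_mem_nhds (show (0 : ℝ) < ε ^ 4 by positivity))).exists
  obtain ⟨W, hW, h⟩ := exists_halving_of_cells (I := Fin N → Prop) (J := Fin N → Prop) hP hQ
    (measurable_pi_lambda _ fun i => (measurable_pi_apply _).comp hφ)
    (measurable_pi_lambda _ fun i => (measurable_pi_apply _).comp hψ) hN hS
  refine ⟨W, hW, fun A B hA hB => ?_⟩
  have := h A B hA hB
  rwa [← Even.pow_abs (by decide : Even 4), pow_le_pow_iff_left₀ (abs_nonneg _) hε.le
    (by norm_num)] at this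

theorem exists_thinning (hP : P.real Set.univ ≤ 1) (hQ : Q.real Set.univ ≤ 1)
    {φ : α → ℕ → Prop} {ψ : β → ℕ → Prop} (hφ : Measurable φ) (hψ : Measurable ψ)
    (hφ0 : (P.prod P) {z | φ z.1 = φ z.2} = 0) (hψ0 : (Q.prod Q) {z | ψ z.1 = ψ z.2} = 0)
    {S : Set (α × β)} (hS : MeasurableSet S) {ε : ℝ} (hε : 0 < ε) (k : ℕ) :
    ∃ W : Set (α × β), MeasurableSet W ∧ ∀ A B, MeasurableSet A → MeasurableSet B →
      |(P.prod Q).real ((A ×ˢ B) ∩ S ∩ W) - (1 / 2) ^ k * (P.prod Q).real ((A ×ˢ B) ∩ S)|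
        ≤ ε := by
  induction k with
  | zero => exact ⟨Set.univ, .univ, fun A B _ _ => by simpa using hε.le⟩
  | succ k ih =>
    obtain ⟨W, hW, h⟩ := ih
    obtain ⟨W', hW', h'⟩ := exists_halving hP hQ hφ hψ hφ0 hψ0 (hS.inter hW) hε
    refine ⟨W ∩ W', hW.inter hW', fun A B hA hB => ?_⟩
    have h1 := abs_le.1 (h A B hA hB)
    have h2 := abs_le.1 (h' A B hA hB)
    simp only [← Set.inter_assoc] at h2 ⊢
    rw [abs_le, pow_succ]
    constructor <;> linarith [h1.1, h1.2, h2.1, h2.2]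

theorem exists_sparse_sets (hP : P.real Set.univ ≤ 1) (hQ : Q.real Set.univ ≤ 1)
    {φ : α → ℕ → Prop} {ψ : β → ℕ → Prop} (hφ : Measurable φ) (hψ : Measurable ψ)
    (hφ0 : (P.prod P) {z | φ z.1 = φ z.2} = 0) (hψ0 : (Q.prod Q) {z | ψ z.1 = ψ z.2} = 0)
    {S : Set (α × β)} (hS : MeasurableSet S) :
    ∃ W : ℕ → Set (α × β), (∀ k, MeasurableSet (W k)) ∧ (∀ k, W k ⊆ S) ∧
      (P.prod Q) (⋂ n, ⋃ k ≥ n, W k) = 0 ∧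
      ∀ A B, MeasurableSet A → MeasurableSet B → (P.prod Q) ((A ×ˢ B) ∩ S) ≠ 0 →
        ∀ n, ∃ k ≥ n, (P.prod Q) ((A ×ˢ B) ∩ W k) ≠ 0 := by
  choose W hW h using fun k : ℕ => exists_thinning hP hQ hφ hψ hφ0 hψ0 hS
    (show (0 : ℝ) < (1 / 2) ^ k * (1 / 2) ^ k by positivity) k
  refine ⟨fun k => S ∩ W k, fun k => hS.inter (hW k), fun k => Set.inter_subset_left, ?_, ?_⟩
  · have hle : ∀ k, (P.prod Q) (S ∩ W k) ≤ ENNReal.ofReal (2 * (1 / 2) ^ k) := by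
      intro k
      have h1 := (abs_le.1 (h k Set.univ Set.univ .univ .univ)).2
      rw [Set.univ_prod_univ, Set.univ_inter] at h1
      rw [ENNReal.le_ofReal_iff_toReal_le (measure_ne_top _ _) (by positivity)]
      have h2 : (P.prod Q).real S ≤ 1 :=
        (measureReal_mono (Set.subset_univ _)).trans (prod_real_univ_le_one hP hQ)
      have h3 : ((1 : ℝ) / 2) ^ k ≤ 1 := pow_le_one₀ (by norm_num) (by norm_num)
      have h4 : (0 : ℝ) < (1 / 2) ^ k := by positivity
      change (P.prod Q).real (S ∩ W k) ≤ _
      nlinarith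
    have hsum : ∑' k, (P.prod Q) (S ∩ W k) ≠ ⊤ := by
      refine ne_top_of_le_ne_top ?_ (ENNReal.tsum_le_tsum hle)
      rw [← ENNReal.ofReal_tsum_of_nonneg (fun k => by positivity)
        (summable_geometric_two.mul_left 2)]
      exact ENNReal.ofReal_ne_top
    have := measure_limsup_atTop_eq_zero hsum
    rw [Filter.limsup_eq_iInf_iSup_of_nat] at this
    simpa using this
  · intro A B hA hB hAB n
    set t := (P.prod Q).real ((A ×ˢ B) ∩ S) with ht
    have ht0 : 0 < t := by
      rw [ht, measureReal_def, ENNReal.toReal_pos_iff]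
      exact ⟨pos_iff_ne_zero.2 hAB, measure_lt_top _ _⟩
    obtain ⟨k, hk⟩ := exists_pow_lt_of_lt_one ht0 (show (1 : ℝ) / 2 < 1 by norm_num)
    refine ⟨max k n, le_max_right _ _, fun h0 => ?_⟩
    have h1 := (abs_le.1 (h (max k n) A B hA hB)).1
    have h2 : ((1 : ℝ) / 2) ^ (max k n) ≤ (1 / 2) ^ k :=
      pow_le_pow_of_le_one (by norm_num) (by norm_num) (le_max_left _ _)
    have h4 : (0 : ℝ) < (1 / 2) ^ (max k n) := by positivity
    rw [Set.inter_assoc, measureReal_def, h0, ENNReal.toReal_zero, ← ht] at h1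
    nlinarith

end sparse

/-- The points of `α` not lying over an atom of the image of `ν` under `φ`. -/
def diffusePart {α τ : Type*} [MeasurableSpace α] (ν : Measure α) (φ : α → τ) : Set α :=
  {y | ν {y' | φ y' = φ y} = 0}

section diffuse

theorem diffusePart_eq_compl {α τ : Type*} [MeasurableSpace α] (ν : Measure α) (φ : α → τ) :
    diffusePart ν φ = (φ ⁻¹' {t | 0 < ν {y' | φ y' = t}})ᶜ := by
  ext y; simp [diffusePart]

variable {α τ : Type*} [MeasurableSpace α] {ν : Measure α} [SFinite ν]
  [MeasurableSpace τ] [MeasurableSingletonClass τ] {φ : α → τ}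

theorem measurableSet_diffusePart (hφ : Measurable φ) : MeasurableSet (diffusePart ν φ) := by
  rw [diffusePart_eq_compl]
  exact (hφ (Measure.countable_meas_level_set_pos hφ).measurableSet).compl

theorem prod_restrict_diffusePart_agree [MeasurableEq τ] (hφ : Measurable φ) (ν' : Measure α)
    [SFinite ν'] (hν' : ν' ≪ ν) :
    ((ν'.restrict (diffusePart ν φ)).prod (ν'.restrict (diffusePart ν φ)))
      {z | φ z.1 = φ z.2} = 0 := by
  have hm : MeasurableSet {z : α × α | φ z.1 = φ z.2} :=
    measurableSet_eq_fun (hφ.comp measurable_fst) (hφ.comp measurable_snd)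
  rw [Measure.measure_prod_null hm]
  refine (ae_restrict_iff' (measurableSet_diffusePart hφ)).2 (.of_forall fun y hy => ?_)
  refine le_antisymm ((Measure.restrict_apply_le _ _).trans (hν' ?_).le) zero_le
  refine measure_mono_null (fun y' hy' => ?_) hy
  exact (show φ y = φ y' from hy').symm

end diffuse

variable {E : Type*} [MeasurableSpace E] {μ : Measure (Measure E)} [SigmaFinite μ]
  {lam : Measure E} [SigmaFinite lam] {c : E → Measure E → ENNReal}

theorem toFinite_real_univ_le_one {α : Type*} [MeasurableSpace α] (ν : Measure α) [SFinite ν]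
    (s : Set α) : (ν.toFinite.restrict s).real Set.univ ≤ 1 := by
  rcases eq_zero_or_neZero ν with rfl | h
  · simp
  · rw [measureReal_restrict_apply .univ, Set.univ_inter]
    exact measureReal_le_one

theorem campbell_diffuse_eq_zero (hc : Measurable (Function.uncurry c))
    (hC : IsCampbell μ (campbell lam μ c)) {A : ℕ → Set E} (hAm : ∀ i, MeasurableSet (A i))
    (hA : ∀ B, MeasurableSet B →
      campbell lam μ c ((B ×ˢ {ξ | ξ B < ⊤}) \ finRegion A) = 0)
    {φ : E → ℕ → Prop} {ψ : Measure E → ℕ → Prop} (hφ : Measurable φ) (hψ : Measurable ψ) :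
    campbell lam μ c ((diffusePart lam φ ×ˢ diffusePart μ ψ) \ finRegion A) = 0 := by
  set C := campbell lam μ c with hCdef
  set Z := (diffusePart lam φ ×ˢ diffusePart μ ψ) \ finRegion A with hZ
  have hE : MeasurableSet (diffusePart lam φ) := measurableSet_diffusePart hφ
  have hX : MeasurableSet (diffusePart μ ψ) := measurableSet_diffusePart hψ
  have hZm : MeasurableSet Z := (hE.prod hX).diff (measurableSet_finRegion hAm)
  have hZA : Disjoint Z (finRegion A) := Set.disjoint_sdiff_left
  set P := lam.toFinite.restrict (diffusePart lam φ) with hP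
  set Q := μ.toFinite.restrict (diffusePart μ ψ) with hQ
  set C' := (C.restrict Z).toFinite with hC'
  have hac : C' ≪ P.prod Q := by
    refine Measure.AbsolutelyContinuous.mk fun D hD h0 => ?_
    refine toFinite_absolutelyContinuous _ ?_
    rw [Measure.restrict_apply hD]
    refine campbell_eq_zero_of_prod_eq_zero hc hA (hD.inter hZm)
      (hZA.mono_left Set.inter_subset_right) ?_
    rw [hP, hQ, Measure.prod_restrict, Measure.restrict_apply hD] at h0
    refine (Measure.AbsolutelyContinuous.prod (absolutelyContinuous_toFinite lam)
      (absolutelyContinuous_toFinite μ)) (measure_mono_null ?_ h0)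
    exact Set.inter_subset_inter_right _ sdiff_le
  set f := C'.rnDeriv (P.prod Q) with hf
  have hfm : Measurable f := Measure.measurable_rnDeriv _ _
  set S := {p | f p ≠ 0} with hS
  have hSm : MeasurableSet S := hfm (measurableSet_singleton 0).compl
  have key : ∀ D, MeasurableSet D → (C (D ∩ Z) = 0 ↔ (P.prod Q) (D ∩ S) = 0) := by
    intro D hD
    have h1 : C (D ∩ Z) = 0 ↔ C' D = 0 := by
      rw [← Measure.restrict_apply hD]
      exact ⟨fun h => toFinite_absolutelyContinuous _ h,
        fun h => absolutelyContinuous_toFinite _ h⟩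
    rw [h1, ← Measure.withDensity_rnDeriv_eq _ _ hac, withDensity_apply_eq_zero hfm,
      Set.inter_comm]
  obtain ⟨W, hWm, hWS, hW0, hW⟩ := exists_sparse_sets (P := P) (Q := Q)
    (toFinite_real_univ_le_one lam _) (toFinite_real_univ_le_one μ _) hφ hψ
    (prod_restrict_diffusePart_agree hφ _ (toFinite_absolutelyContinuous _))
    (prod_restrict_diffusePart_agree hψ _ (toFinite_absolutelyContinuous _)) hSm
  have hUm : ∀ n, MeasurableSet (⋃ k ≥ n, W k) := fun n =>
    .iUnion fun k => .iUnion fun _ => hWm k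
  have hT : ∀ n, C (Z \ ⋃ k ≥ n, W k) = 0 := by
    intro n
    refine hC.measure_eq_zero_of_disjoint_finRegion hA (hZm.diff (hUm n))
      (hZA.mono_left sdiff_le) fun B s hB hs htop => ?_
    by_cases h0 : C ((B ×ˢ s) ∩ Z) = 0
    · rw [← htop]
      refine le_antisymm (measure_mono sdiff_le) ?_
      rw [← measure_sdiff_null' h0]
      exact measure_mono fun p hp => ⟨hp.1, fun h => hp.2 h.1⟩
    · obtain ⟨k, hk, hk0⟩ := hW B s hB hs (fun h => h0 ((key _ (hB.prod hs)).2 h)) n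
      have h1 : C ((B ×ˢ s) ∩ W k ∩ Z) ≠ 0 := fun h => hk0 (by
        have := (key _ ((hB.prod hs).inter (hWm k))).1 h
        rwa [Set.inter_assoc, Set.inter_eq_left.2 (hWS k)] at this)
      have h2 : C ((B ×ˢ s) ∩ W k ∩ Z) = ⊤ := by
        by_contra h
        exact h1 (hC.measure_eq_zero_of_ne_top hA (((hB.prod hs).inter (hWm k)).inter hZm)
          (hZA.mono_left Set.inter_subset_right) h)
      refine top_le_iff.1 (h2 ▸ measure_mono fun p hp => ⟨hp.1.1, fun h => h.2 ?_⟩)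
      exact Set.mem_iUnion₂.2 ⟨k, hk, hp.1.2⟩
  have hL : C ((⋂ n, ⋃ k ≥ n, W k) ∩ Z) = 0 :=
    (key _ (.iInter hUm)).2 (measure_mono_null Set.inter_subset_left hW0)
  refine measure_mono_null (t := ((⋂ n, ⋃ k ≥ n, W k) ∩ Z) ∪ ⋃ n, Z \ ⋃ k ≥ n, W k) ?_
    (measure_union_null hL (measure_iUnion_null hT))
  intro p hp
  by_cases h : p ∈ ⋂ n, ⋃ k ≥ n, W k
  · exact .inl ⟨h, hp⟩
  · obtain ⟨n, hn⟩ := not_forall.1 (fun h' => h (Set.mem_iInter.2 h'))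
    exact .inr (Set.mem_iUnion.2 ⟨n, hp, hn⟩)

end

section

theorem withDensity_campbell_prod {E : Type*} [MeasurableSpace E] {μ : Measure (Measure E)}
    {C : Measure (E × Measure E)} (hC : IsCampbell μ C) {ρ : Measure E → ENNReal}
    (hρ : Measurable ρ) {B : Set E} (hB : MeasurableSet B) {s : Set (Measure E)}
    (hs : MeasurableSet s) :
    C.withDensity (fun p => ρ p.2) (B ×ˢ s) = ∫⁻ ξ in s, ξ B ∂μ.withDensity ρ := by
  have hm := hB.prod hs
  have hi : Measurable (s.indicator fun ξ : Measure E => ξ B) :=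
    (Measure.measurable_coe hB).indicator hs
  have hρ' : Measurable fun p : E × Measure E => ρ p.2 := hρ.comp measurable_snd
  have hm' : Measurable fun p : E × Measure E =>
      (B ×ˢ s).indicator (1 : E × Measure E → ENNReal) p * ρ p.2 :=
    (measurable_one.indicator hm).mul hρ'
  rw [← lintegral_indicator_one hm, lintegral_withDensity hρ' (measurable_one.indicator hm),
    ← lintegral_indicator hs, lintegral_withDensity hρ hi, ← hC _ hm']
  refine lintegral_congr fun ξ => ?_
  by_cases h : ξ ∈ s
  · have e : ∀ y, (B ×ˢ s).indicator (1 : E × Measure E → ENNReal) (y, ξ)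
        = B.indicator 1 y := fun y => by by_cases hy : y ∈ B <;> simp [hy, h]
    simp only [e, h, Set.indicator_of_mem]
    rw [lintegral_mul_const _ (measurable_one.indicator hB), lintegral_indicator_one hB]
  · simp [h]

section shift

variable {E : Type*} [MeasurableSpace E] {μ : Measure (Measure E)} [SigmaFinite μ]
  {lam : Measure E} {C : Measure (E × Measure E)} [SFinite C]
  {c : E → Measure E → ENNReal} {f : E × Measure E → ENNReal}

/-- The law of the configuration after a point is added with density `f`. -/
noncomputable def shiftLaw (lam : Measure E) (μ : Measure (Measure E))
    (f : E × Measure E → ENNReal) : Measure (Measure E) :=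
  ((lam.prod μ).withDensity f).map fun p => p.2 + Measure.dirac p.1

/-- The Campbell measure of the configuration after a point is added with density `f`,
split according to whether the typical point is the added one. -/
noncomputable def shiftCampbell (lam : Measure E) (μ : Measure (Measure E))
    (C : Measure (E × Measure E)) (f : E × Measure E → ENNReal) : Measure (E × Measure E) :=
  ((lam.prod μ).withDensity f).map (fun p => (p.1, p.2 + Measure.dirac p.1)) +
  ((lam.prod C).withDensity fun q => f (q.1, q.2.2)).map
    fun q => (q.2.1, q.2.2 + Measure.dirac q.1)

theorem measurable_shift_snd :
    Measurable fun q : E × E × Measure E => (q.2.1, q.2.2 + Measure.dirac q.1) := by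
  refine (measurable_fst.comp measurable_snd).prodMk ?_
  exact (measurable_snd.comp measurable_snd).add (Measure.measurable_dirac.comp measurable_fst)

theorem measurable_forget (hf : Measurable f) :
    Measurable fun q : E × E × Measure E => f (q.1, q.2.2) :=
  hf.comp (measurable_fst.prodMk (measurable_snd.comp measurable_snd))

theorem measurable_add_dirac_const (x : E) : Measurable fun ξ : Measure E => ξ + Measure.dirac x :=
  measurable_add_dirac.comp (measurable_const.prodMk measurable_id)

theorem measurable_shift_const (x : E) :
    Measurable fun p : E × Measure E => (p.1, p.2 + Measure.dirac x) :=
  measurable_fst.prodMk ((measurable_add_dirac_const x).comp measurable_snd)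

theorem lintegral_shiftLaw (hf : Measurable f) {h : Measure E → ENNReal} (hh : Measurable h) :
    ∫⁻ ξ, h ξ ∂shiftLaw lam μ f
      = ∫⁻ x, ∫⁻ ξ, h (ξ + Measure.dirac x) * f (x, ξ) ∂μ ∂lam := by
  rw [shiftLaw, lintegral_map hh measurable_add_dirac]
  refine (lintegral_withDensity hf (hh.comp measurable_add_dirac)).trans ?_
  exact lintegral_prod _ ((hh.comp measurable_add_dirac).mul hf).aemeasurable

theorem lintegral_shiftCampbell (hf : Measurable f) {w : E × Measure E → ENNReal}
    (hw : Measurable w) :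
    ∫⁻ p, w p ∂shiftCampbell lam μ C f
      = ∫⁻ x, (∫⁻ ξ, w (x, ξ + Measure.dirac x) * f (x, ξ) ∂μ +
          ∫⁻ p, w (p.1, p.2 + Measure.dirac x) * f (x, p.2) ∂C) ∂lam := by
  have h1 : Measurable fun p : E × Measure E => w (p.1, p.2 + Measure.dirac p.1) * f p :=
    (hw.comp measurable_prodMk_add_dirac).mul hf
  have h2 := (hw.comp measurable_shift_snd).mul (measurable_forget hf)
  have h3 : Measurable fun x : E => ∫⁻ ξ, w (x, ξ + Measure.dirac x) * f (x, ξ) ∂μ :=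
    h1.lintegral_prod_right'
  rw [shiftCampbell, lintegral_add_measure, lintegral_map hw measurable_prodMk_add_dirac,
    lintegral_map hw measurable_shift_snd, lintegral_add_left h3]
  congr 1
  · refine (lintegral_withDensity hf (hw.comp measurable_prodMk_add_dirac)).trans ?_
    exact lintegral_prod _ h1.aemeasurable
  · refine (lintegral_withDensity (measurable_forget hf) (hw.comp measurable_shift_snd)).trans ?_
    exact lintegral_prod _ h2.aemeasurable

theorem shiftCampbell_prod (hC : IsCampbell μ C) (hf : Measurable f) {B : Set E}
    (hB : MeasurableSet B) {s : Set (Measure E)} (hs : MeasurableSet s) :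
    shiftCampbell lam μ C f (B ×ˢ s) = ∫⁻ ξ in s, ξ B ∂shiftLaw lam μ f := by
  have hm := hB.prod hs
  have hi : Measurable (s.indicator fun ξ : Measure E => ξ B) :=
    (Measure.measurable_coe hB).indicator hs
  rw [← lintegral_indicator_one hm, lintegral_shiftCampbell hf (measurable_one.indicator hm),
    ← lintegral_indicator hs, lintegral_shiftLaw hf hi]
  refine lintegral_congr fun x => ?_
  have hw : Measurable fun p : E × Measure E =>
      (B ×ˢ s).indicator (1 : E × Measure E → ENNReal) (p.1, p.2 + Measure.dirac x) *
        f (x, p.2) :=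
    ((measurable_one.indicator hm).comp (measurable_shift_const x)).mul
      (hf.comp (measurable_const.prodMk measurable_snd))
  rw [← hC _ hw, ← lintegral_add_left]
  · refine lintegral_congr fun ξ => ?_
    by_cases h : ξ + Measure.dirac x ∈ s
    · have e : ∀ y, (B ×ˢ s).indicator (1 : E × Measure E → ENNReal) (y, ξ + Measure.dirac x)
          = B.indicator 1 y := fun y => by by_cases hy : y ∈ B <;> simp [hy, h]
      simp only [e, h, Set.indicator_of_mem, Measure.add_apply]
      rw [lintegral_mul_const _ (measurable_one.indicator hB), lintegral_indicator_one hB,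
        Measure.dirac_apply' _ hB]
      ring
    · simp [h]
  · exact ((measurable_one.indicator hm).comp
      (measurable_const.prodMk (measurable_add_dirac_const x))).mul
      (hf.comp (measurable_const.prodMk measurable_id))

variable [SigmaFinite lam]

theorem shiftLaw_absolutelyContinuous (hc : Measurable (Function.uncurry c))
    (hC : IsCampbell μ (campbell lam μ c)) (hf : Measurable f)
    (hfc : ∀ x ξ, c x ξ = 0 → f (x, ξ) = 0) : shiftLaw lam μ f ≪ μ := by
  refine Measure.AbsolutelyContinuous.mk fun s hs h0 => ?_
  have h1 : campbell lam μ c (Set.univ ×ˢ s) = 0 := by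
    rw [hC.measure_prod .univ hs, Measure.restrict_eq_zero.2 h0, lintegral_zero_measure]
  have hm : MeasurableSet (Set.univ ×ˢ s : Set (E × Measure E)) := MeasurableSet.univ.prod hs
  have hmc : Measurable fun p : E × Measure E =>
      (Set.univ ×ˢ s).indicator (1 : E × Measure E → ENNReal) (p.1, p.2 + Measure.dirac p.1) *
        c p.1 p.2 :=
    ((measurable_one.indicator hm).comp measurable_prodMk_add_dirac).mul hc
  rw [← lintegral_indicator_one hm, lintegral_campbell hc (measurable_one.indicator hm),
    lintegral_eq_zero_iff hmc] at h1
  rw [shiftLaw, Measure.map_apply measurable_add_dirac hs, withDensity_apply_eq_zero hf]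
  refine measure_mono_null (fun p hp => ?_) (ae_iff.1 h1)
  have hs' : p.2 + Measure.dirac p.1 ∈ s := hp.2
  simpa [hs'] using mt (hfc p.1 p.2) hp.1

theorem restrict_finRegion_eq {A : ℕ → Set E} (hA : ∀ i, MeasurableSet (A i))
    {κ : Measure (Measure E)} [IsFiniteMeasure κ] {M N : Measure (E × Measure E)}
    (hM : ∀ B s, MeasurableSet B → MeasurableSet s → M (B ×ˢ s) = ∫⁻ ξ in s, ξ B ∂κ)
    (hN : ∀ B s, MeasurableSet B → MeasurableSet s → N (B ×ˢ s) = ∫⁻ ξ in s, ξ B ∂κ) :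
    M.restrict (finRegion A) = N.restrict (finRegion A) := by
  have hR : ∀ i (n : ℕ), MeasurableSet {ξ : Measure E | ξ (A i) ≤ n} := fun i n =>
    measurableSet_le (Measure.measurable_coe (hA i)) measurable_const
  have hU : finRegion A = ⋃ i, ⋃ n : ℕ, A i ×ˢ {ξ : Measure E | ξ (A i) ≤ (n : ENNReal)} := by
    refine Set.iUnion_congr fun i => ?_
    ext ⟨y, ξ⟩
    simp only [Set.mem_prod, Set.mem_ofPred_eq, Set.mem_iUnion, exists_and_left]
    refine and_congr_right fun _ => ⟨fun h => ?_, fun ⟨n, h⟩ => h.trans_lt (by simp)⟩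
    obtain ⟨n, hn⟩ := ENNReal.exists_nat_gt h.ne
    exact ⟨n, hn.le⟩
  rw [hU, Measure.restrict_iUnion_congr]
  intro i
  rw [Measure.restrict_iUnion_congr]
  intro n
  have : IsFiniteMeasure (M.restrict (A i ×ˢ {ξ : Measure E | ξ (A i) ≤ (n : ENNReal)})) := by
    refine ⟨?_⟩
    rw [Measure.restrict_apply_univ, hM _ _ (hA i) (hR i n)]
    calc ∫⁻ ξ in {ξ | ξ (A i) ≤ n}, ξ (A i) ∂κ
        ≤ ∫⁻ ξ in {ξ | ξ (A i) ≤ n}, (n : ENNReal) ∂κ :=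
          setLIntegral_mono measurable_const fun ξ hξ => hξ
      _ < ⊤ := by
          rw [setLIntegral_const]
          exact ENNReal.mul_lt_top (by simp) (measure_lt_top _ _)
  refine Measure.ext_prod fun {B s} hB hs => ?_
  rw [Measure.restrict_apply (hB.prod hs), Measure.restrict_apply (hB.prod hs),
    Set.prod_inter_prod, hM _ _ (hB.inter (hA i)) (hs.inter (hR i n)),
    hN _ _ (hB.inter (hA i)) (hs.inter (hR i n))]

theorem add_dirac_lt_top_iff {B : Set E} (x : E) (ξ : Measure E) :
    (ξ + Measure.dirac x) B < ⊤ ↔ ξ B < ⊤ := by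
  rw [Measure.add_apply, ENNReal.add_lt_top]
  exact and_iff_left (measure_lt_top _ _)

theorem shiftCampbell_diffuse_eq_zero (hc : Measurable (Function.uncurry c))
    (hC : IsCampbell μ (campbell lam μ c)) {A : ℕ → Set E} (hAm : ∀ i, MeasurableSet (A i))
    (hA : ∀ B, MeasurableSet B →
      campbell lam μ c ((B ×ˢ {ξ | ξ B < ⊤}) \ finRegion A) = 0)
    (hf : Measurable f) (hfc : ∀ x ξ, c x ξ = 0 → f (x, ξ) = 0)
    {φ : E → ℕ → Prop} {ψ : Measure E → ℕ → Prop} (hφ : Measurable φ) (hψ : Measurable ψ)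
    (hψA : ∀ ξ ξ', ψ ξ = ψ ξ' → ∀ i, ξ (A i) < ⊤ ↔ ξ' (A i) < ⊤)
    (hR : ∀ B s, MeasurableSet B → MeasurableSet s → campbell lam μ c (B ×ˢ s) = 0 →
      shiftCampbell lam μ (campbell lam μ c) f (B ×ˢ s) = 0) :
    shiftCampbell lam μ (campbell lam μ c) f
      ((diffusePart lam φ ×ˢ diffusePart μ ψ) \ finRegion A) = 0 := by
  set C := campbell lam μ c with hCdef
  set Z := (diffusePart lam φ ×ˢ diffusePart μ ψ) \ finRegion A with hZ
  have hE : MeasurableSet (diffusePart lam φ) := measurableSet_diffusePart hφ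
  have hX : MeasurableSet (diffusePart μ ψ) := measurableSet_diffusePart hψ
  have hU := measurableSet_finRegion hAm
  have hZm : MeasurableSet Z := (hE.prod hX).diff hU
  have hCZ : C Z = 0 := campbell_diffuse_eq_zero hc hC hAm hA hφ hψ
  rw [shiftCampbell, Measure.add_apply, add_eq_zero]
  constructor
  · have h1 := hCZ
    have hmc : Measurable fun p : E × Measure E =>
        Z.indicator (1 : E × Measure E → ENNReal) (p.1, p.2 + Measure.dirac p.1) * c p.1 p.2 :=
      ((measurable_one.indicator hZm).comp measurable_prodMk_add_dirac).mul hc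
    rw [← lintegral_indicator_one hZm, lintegral_campbell hc (measurable_one.indicator hZm),
      lintegral_eq_zero_iff hmc] at h1
    rw [Measure.map_apply measurable_prodMk_add_dirac hZm, withDensity_apply_eq_zero hf]
    refine measure_mono_null (fun p hp => ?_) (ae_iff.1 h1)
    have hs' : (p.1, p.2 + Measure.dirac p.1) ∈ Z := hp.2
    simpa [hs'] using mt (hfc p.1 p.2) hp.1
  · set M := (lam.prod C).withDensity fun q => f (q.1, q.2.2) with hM
    set T : E × E × Measure E → E × Measure E :=
      fun q => (q.2.1, q.2.2 + Measure.dirac q.1) with hT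
    have hTm : Measurable T := measurable_shift_snd
    rw [Measure.map_apply hTm hZm]
    set at' : Set (ℕ → Prop) := {t | 0 < μ {ξ | ψ ξ = t}} with hat
    have hatc : at'.Countable := Measure.countable_meas_level_set_pos hψ
    have hrep : ∀ t ∈ at', ∃ ξ, ψ ξ = t := fun t ht => nonempty_of_measure_ne_zero ht.ne'
    choose! r hr using hrep
    let Es : (ℕ → Prop) → Set E := fun t => diffusePart lam φ ∩ {y | (y, r t) ∉ finRegion A}
    let Xs : (ℕ → Prop) → Set (Measure E) := fun t =>
      diffusePart μ ψ ∩ ⋂ i, {ξ | ξ (A i) < ⊤ ↔ r t (A i) < ⊤}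
    have hEs : ∀ t, MeasurableSet (Es t) := fun t => hE.inter (measurable_prodMk_right hU).compl
    have hXs : ∀ t, MeasurableSet (Xs t) := fun t => hX.inter <| .iInter fun i => by
      by_cases h : r t (A i) < ⊤
      · simpa [h] using measurableSet_eval_lt_top (hAm i)
      · simp only [h, iff_false]
        exact (measurableSet_eval_lt_top (hAm i)).compl
    have hsub : T ⁻¹' Z ⊆ Prod.snd ⁻¹' Z ∪ ⋃ t ∈ at', T ⁻¹' (Es t ×ˢ Xs t) := by
      rintro ⟨x, y, ξ⟩ hq
      obtain ⟨⟨hy, hξ⟩, hn⟩ := hq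
      have hn' : (y, ξ) ∉ finRegion A := by
        simp only [hT, finRegion, Set.mem_iUnion, Set.mem_prod, Set.mem_ofPred_eq, not_exists,
          add_dirac_lt_top_iff] at hn ⊢
        exact hn
      by_cases hd : ξ ∈ diffusePart μ ψ
      · exact .inl ⟨⟨hy, hd⟩, hn'⟩
      · right
        have ht : ψ ξ ∈ at' := pos_iff_ne_zero.2 hd
        have hp := hψA _ _ (hr _ ht)
        refine Set.mem_iUnion₂.2 ⟨ψ ξ, ht, ⟨hy, ?_⟩, hξ, Set.mem_iInter.2 fun i => ?_⟩
        · simp only [finRegion, Set.mem_iUnion, Set.mem_prod, Set.mem_ofPred_eq, hp] at hn' ⊢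
          exact hn'
        · simp only [hT, Set.mem_ofPred_eq, add_dirac_lt_top_iff, hp]
    have hM0 : M (Prod.snd ⁻¹' Z) = 0 := by
      refine withDensity_absolutelyContinuous _ _ ?_
      rw [← Set.univ_prod, Measure.prod_prod, hCZ, mul_zero]
    refine measure_mono_null hsub (measure_union_null hM0 ?_)
    refine (measure_biUnion_null_iff hatc).2 fun t _ => ?_
    have h0 : C (Es t ×ˢ Xs t) = 0 := by
      refine measure_mono_null (t := Z) (fun p hp => ?_) hCZ
      refine ⟨⟨hp.1.1, hp.2.1⟩, fun h => hp.1.2 ?_⟩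
      have h2 := fun i => Set.mem_iInter.1 hp.2.2 i
      simp only [finRegion, Set.mem_iUnion, Set.mem_prod, Set.mem_ofPred_eq] at h h2 ⊢
      obtain ⟨i, hi⟩ := h
      exact ⟨i, hi.1, (h2 i).1 hi.2⟩
    have := hR _ _ (hEs t) (hXs t) h0
    rw [shiftCampbell, Measure.add_apply, add_eq_zero] at this
    rw [← Measure.map_apply hTm ((hEs t).prod (hXs t))]
    exact this.2

end shift

end

section

theorem measure_biUnion_congr {ι α : Type*} [MeasurableSpace α] {M N : Measure α} {s : Set ι}
    (hs : s.Countable) {f : ι → Set α} (hd : s.PairwiseDisjoint f)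
    (hm : ∀ i ∈ s, MeasurableSet (f i)) (h : ∀ i ∈ s, M (f i) = N (f i)) :
    M (⋃ i ∈ s, f i) = N (⋃ i ∈ s, f i) := by
  rw [measure_biUnion hs hd hm, measure_biUnion hs hd hm]
  exact tsum_congr fun i => h i i.2

theorem pairwiseDisjoint_inter_fiber {ι α : Type*} (φ : α → ι) (D : Set α) (s : Set ι) :
    s.PairwiseDisjoint fun t => D ∩ φ ⁻¹' {t} := by
  intro t _ t' _ hne
  refine Set.disjoint_left.2 fun p hp hp' => hne ?_
  exact (show φ p = t from hp.2).symm.trans hp'.2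

theorem isFiniteMeasure_shiftLaw {E : Type*} [MeasurableSpace E]
    {μ : Measure (Measure E)} {lam : Measure E} {f : E × Measure E → ENNReal}
    (hfin : ∫⁻ p, f p ∂lam.prod μ ≠ ⊤) :
    IsFiniteMeasure (shiftLaw lam μ f) := by
  have := isFiniteMeasure_withDensity hfin
  unfold shiftLaw
  infer_instance

variable {E : Type*} [MeasurableSpace E] {μ : Measure (Measure E)} [SigmaFinite μ]
  {lam : Measure E} [SigmaFinite lam]
  {c : E → Measure E → ENNReal} {f : E × Measure E → ENNReal}

theorem shiftCampbell_le (hc : Measurable (Function.uncurry c))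
    (hC : IsCampbell μ (campbell lam μ c)) (hf : Measurable f)
    (hfc : ∀ x ξ, c x ξ = 0 → f (x, ξ) = 0) (hfin : ∫⁻ p, f p ∂lam.prod μ ≠ ⊤) :
    shiftCampbell lam μ (campbell lam μ c) f ≤
      (campbell lam μ c).withDensity fun p => (shiftLaw lam μ f).rnDeriv μ p.2 := by
  set C := campbell lam μ c with hCdef
  set N := shiftCampbell lam μ C f with hN
  have := isFiniteMeasure_shiftLaw hfin
  set κ := shiftLaw lam μ f with hκ
  set ρ := κ.rnDeriv μ with hρ
  have hρm : Measurable ρ := Measure.measurable_rnDeriv _ _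
  set M := C.withDensity fun p => ρ p.2 with hM
  have hκρ : μ.withDensity ρ = κ :=
    Measure.withDensity_rnDeriv_eq _ _ (shiftLaw_absolutelyContinuous hc hC hf hfc)
  have hNr : ∀ B s, MeasurableSet B → MeasurableSet s → N (B ×ˢ s) = ∫⁻ ξ in s, ξ B ∂κ :=
    fun B s hB hs => shiftCampbell_prod hC hf hB hs
  have hMr : ∀ B s, MeasurableSet B → MeasurableSet s → M (B ×ˢ s) = ∫⁻ ξ in s, ξ B ∂κ :=
    fun B s hB hs => hκρ ▸ withDensity_campbell_prod hC hρm hB hs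
  have hNM : ∀ B s, MeasurableSet B → MeasurableSet s → N (B ×ˢ s) = M (B ×ˢ s) :=
    fun B s hB hs => (hNr B s hB hs).trans (hMr B s hB hs).symm
  obtain ⟨A, hAm, hA⟩ := exists_maximal_finRegion C
  have hU := measurableSet_finRegion hAm
  refine Measure.le_iff.2 fun D₀ hD₀ => ?_
  rw [← measure_inter_add_sdiff D₀ hU, ← measure_inter_add_sdiff (μ := M) D₀ hU,
    ← Measure.restrict_apply hD₀, ← Measure.restrict_apply hD₀,
    restrict_finRegion_eq hAm hNr hMr]
  refine add_le_add le_rfl ?_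
  obtain ⟨S, R, hS, hR, hSR⟩ := exists_seq_rect_determines hD₀
  set D := D₀ \ finRegion A with hD
  have hDm : MeasurableSet D := hD₀.diff hU
  let φ : E → ℕ → Prop := fun y k => y ∈ Sum.elim S A (Equiv.natSumNatEquivNat.symm k)
  let ψ : Measure E → ℕ → Prop := fun ξ k =>
    ξ ∈ Sum.elim R (fun i => {ξ : Measure E | ξ (A i) < ⊤}) (Equiv.natSumNatEquivNat.symm k)
  have hφ : Measurable φ := measurable_pi_iff.2 fun k => by
    refine MeasurableSet.mem ?_
    cases Equiv.natSumNatEquivNat.symm k with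
    | inl i => exact hS i
    | inr i => exact hAm i
  have hψ : Measurable ψ := measurable_pi_iff.2 fun k => by
    refine MeasurableSet.mem ?_
    cases Equiv.natSumNatEquivNat.symm k with
    | inl i => exact hR i
    | inr i => exact measurableSet_eval_lt_top (hAm i)
  have hφe : ∀ {y y'}, φ y = φ y' → (∀ i, y ∈ S i ↔ y' ∈ S i) ∧ ∀ i, y ∈ A i ↔ y' ∈ A i := by
    intro y y' h
    refine ⟨fun i => ?_, fun i => ?_⟩
    · simpa [φ] using congrFun h (Equiv.natSumNatEquivNat (.inl i))
    · simpa [φ] using congrFun h (Equiv.natSumNatEquivNat (.inr i))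
  have hψe : ∀ {ξ ξ'}, ψ ξ = ψ ξ' → (∀ i, ξ ∈ R i ↔ ξ' ∈ R i) ∧
      ∀ i, ξ (A i) < ⊤ ↔ ξ' (A i) < ⊤ := by
    intro y y' h
    refine ⟨fun i => ?_, fun i => ?_⟩
    · simpa [ψ] using congrFun h (Equiv.natSumNatEquivNat (.inl i))
    · simpa [ψ] using congrFun h (Equiv.natSumNatEquivNat (.inr i))
  have hDe : ∀ {y y' ξ ξ'}, φ y = φ y' → ψ ξ = ψ ξ' → ((y, ξ) ∈ D ↔ (y', ξ') ∈ D) := by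
    intro y y' ξ ξ' h h'
    refine and_congr (hSR _ _ _ _ (hφe h).1 (hψe h').1) (not_congr ?_)
    simp only [finRegion, Set.mem_iUnion, Set.mem_prod, Set.mem_ofPred_eq]
    exact exists_congr fun i => and_congr ((hφe h).2 i) ((hψe h').2 i)
  set T : Set (ℕ → Prop) := {t | 0 < lam {y | φ y = t}} with hT
  set T' : Set (ℕ → Prop) := {t | 0 < μ {ξ | ψ ξ = t}} with hT'
  have hTc : T.Countable := Measure.countable_meas_level_set_pos hφ
  have hTc' : T'.Countable := Measure.countable_meas_level_set_pos hψ
  have hE : MeasurableSet (diffusePart lam φ) := measurableSet_diffusePart hφ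
  set D₁ := ⋃ t ∈ T, D ∩ (fun p => φ p.1) ⁻¹' {t} with hD₁
  set Dd := D ∩ (diffusePart lam φ) ×ˢ Set.univ with hDd
  have hDdm : MeasurableSet Dd := hDm.inter (hE.prod .univ)
  set D₂ := ⋃ t ∈ T', Dd ∩ (fun p => ψ p.2) ⁻¹' {t} with hD₂
  have hm₁ : ∀ t ∈ T, MeasurableSet (D ∩ (fun p => φ p.1) ⁻¹' {t}) := fun t _ =>
    hDm.inter ((hφ.comp measurable_fst) (measurableSet_singleton t))
  have hm₂ : ∀ t ∈ T', MeasurableSet (Dd ∩ (fun p => ψ p.2) ⁻¹' {t}) := fun t _ =>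
    hDdm.inter ((hψ.comp measurable_snd) (measurableSet_singleton t))
  have h₁ : N D₁ = M D₁ := by
    refine measure_biUnion_congr hTc (pairwiseDisjoint_inter_fiber _ _ _) hm₁ fun t ht => ?_
    obtain ⟨r, hr⟩ : ∃ y, φ y = t := nonempty_of_measure_ne_zero ht.ne'
    have : D ∩ (fun p => φ p.1) ⁻¹' {t} = (φ ⁻¹' {t}) ×ˢ (Prod.mk r ⁻¹' D) := by
      ext ⟨y, ξ⟩
      simp only [Set.mem_inter_iff, Set.mem_preimage, Set.mem_singleton_iff, Set.mem_prod]
      rw [and_comm]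
      exact and_congr_right fun h => hDe (h.trans hr.symm) rfl
    rw [this]
    exact hNM _ _ (hφ (measurableSet_singleton t)) (measurable_prodMk_left hDm)
  have h₂ : N D₂ = M D₂ := by
    refine measure_biUnion_congr hTc' (pairwiseDisjoint_inter_fiber _ _ _) hm₂ fun t ht => ?_
    obtain ⟨r, hr⟩ : ∃ ξ, ψ ξ = t := nonempty_of_measure_ne_zero ht.ne'
    have : Dd ∩ (fun p => ψ p.2) ⁻¹' {t} = ((fun y => (y, r)) ⁻¹' Dd) ×ˢ (ψ ⁻¹' {t}) := by
      ext ⟨y, ξ⟩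
      simp only [Set.mem_inter_iff, Set.mem_preimage, Set.mem_singleton_iff, Set.mem_prod]
      refine and_congr_left fun h => and_congr (hDe rfl (h.trans hr.symm)) ?_
      simp
    rw [this]
    exact hNM _ _ (measurable_prodMk_right hDdm) (hψ (measurableSet_singleton t))
  have hZ : N ((diffusePart lam φ ×ˢ diffusePart μ ψ) \ finRegion A) = 0 := by
    refine shiftCampbell_diffuse_eq_zero hc hC hAm hA hf hfc hφ hψ
      (fun ξ ξ' h => (hψe h).2) fun B s hB hs h0 => ?_
    exact (hNM B s hB hs).trans (withDensity_absolutelyContinuous _ _ h0)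
  have hsub : D ⊆ (D₁ ∪ D₂) ∪ (diffusePart lam φ ×ˢ diffusePart μ ψ) \ finRegion A := by
    rintro ⟨y, ξ⟩ hp
    by_cases h : y ∈ diffusePart lam φ
    · by_cases h' : ξ ∈ diffusePart μ ψ
      · exact .inr ⟨⟨h, h'⟩, hp.2⟩
      · exact .inl (.inr (Set.mem_iUnion₂.2 ⟨ψ ξ, pos_iff_ne_zero.2 h', ⟨hp, h, trivial⟩, rfl⟩))
    · exact .inl (.inl (Set.mem_iUnion₂.2 ⟨φ y, pos_iff_ne_zero.2 h, hp, rfl⟩))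
  have hdisj : Disjoint D₁ D₂ := by
    refine Set.disjoint_left.2 fun p hp hp' => ?_
    obtain ⟨t, ht, h1⟩ := Set.mem_iUnion₂.1 hp
    obtain ⟨t', ht', h2⟩ := Set.mem_iUnion₂.1 hp'
    have h3 : lam {y' | φ y' = φ p.1} = 0 := h2.1.2.1
    rw [show φ p.1 = t from h1.2] at h3
    exact ht.ne' h3
  calc N D ≤ N ((D₁ ∪ D₂) ∪ (diffusePart lam φ ×ˢ diffusePart μ ψ) \ finRegion A) :=
        measure_mono hsub
    _ ≤ N (D₁ ∪ D₂) + 0 := (measure_union_le _ _).trans (add_le_add le_rfl hZ.le)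
    _ ≤ M D₁ + M D₂ := by
        rw [add_zero, ← h₁, ← h₂]
        exact measure_union_le _ _
    _ = M (D₁ ∪ D₂) := (measure_union hdisj (.biUnion hTc' hm₂)).symm
    _ ≤ M D := measure_mono <| Set.union_subset
        (Set.iUnion₂_subset fun t _ => Set.inter_subset_left)
        (Set.iUnion₂_subset fun t _ => Set.inter_subset_left.trans Set.inter_subset_left)

end

section

variable {E : Type*} [MeasurableSpace E] {μ : Measure (Measure E)}
  {lam : Measure E} [SigmaFinite lam]
  {c : E → Measure E → ENNReal} {u : E × Measure E → ENNReal}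

theorem lowerDensity_add_dirac_le [SigmaFinite μ] (hu : Measurable u) (x : E) :
    ∀ᵐ ξ ∂μ, lowerDensity μ u (ξ + Measure.dirac x) ≤
      u (x, ξ + Measure.dirac x) + lowerDensity μ (fun p => u (p.1, p.2 + Measure.dirac x)) ξ := by
  have hθ := measurable_add_dirac_const x
  have hx : Measurable fun ξ : Measure E => u (x, ξ + Measure.dirac x) :=
    hu.comp (measurable_const.prodMk hθ)
  have hg : Measurable fun ξ : Measure E =>
      lowerDensity μ u (ξ + Measure.dirac x) - u (x, ξ + Measure.dirac x) :=
    (measurable_lowerDensity.comp hθ).sub hx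
  have := IsCampbell.le_lowerDensity_ae (μ := μ)
    (w := fun p => u (p.1, p.2 + Measure.dirac x)) hg fun ξ => by
      rw [tsub_le_iff_right]
      refine (lowerDensity_le _).trans ?_
      rw [lintegral_add_measure]
      exact add_le_add le_rfl (lintegral_dirac' x (hu.comp measurable_prodMk_right)).le
  filter_upwards [this] with ξ hξ using tsub_le_iff_left.1 hξ

theorem lintegral_density_shiftLaw [SigmaFinite μ] (hc : Measurable (Function.uncurry c))
    (hC : IsCampbell μ (campbell lam μ c)) {f : E × Measure E → ENNReal} (hf : Measurable f)
    (hfc : ∀ x ξ, c x ξ = 0 → f (x, ξ) = 0) (hfin : ∫⁻ p, f p ∂lam.prod μ ≠ ⊤)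
    (hu : Measurable u) :
    ∫⁻ p, u p ∂shiftCampbell lam μ (campbell lam μ c) f ≤
      ∫⁻ ξ, lowerDensity μ u ξ ∂shiftLaw lam μ f := by
  have hρ : Measurable ((shiftLaw lam μ f).rnDeriv μ) := Measure.measurable_rnDeriv _ _
  refine (lintegral_mono' (shiftCampbell_le hc hC hf hfc hfin) le_rfl).trans ?_
  have := isFiniteMeasure_shiftLaw hfin
  conv_rhs => rw [← Measure.withDensity_rnDeriv_eq _ _ (shiftLaw_absolutelyContinuous hc hC hf hfc),
    lintegral_withDensity hρ measurable_lowerDensity]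
  refine ((lintegral_withDensity (hρ.comp measurable_snd) hu).trans ?_).le
  simp_rw [mul_comm (lowerDensity μ u _)]
  rw [hC.lintegral_mul_lowerDensity hu hρ]
  simp_rw [mul_comm (u _)]
  rfl

theorem lowerDensity_add_dirac_of_le [IsFiniteMeasure μ] (hc : Measurable (Function.uncurry c))
    (hC : IsCampbell μ (campbell lam μ c)) (hu : Measurable u) (n : ℕ) :
    ∀ᵐ x ∂lam, ∀ᵐ ξ ∂μ, c x ξ ≠ 0 → lowerDensity μ u (ξ + Measure.dirac x) ≤ n →
      lowerDensity μ u (ξ + Measure.dirac x) = u (x, ξ + Measure.dirac x) +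
        lowerDensity μ (fun p => u (p.1, p.2 + Measure.dirac x)) ξ := by
  obtain ⟨p, hp0, hpm, hp⟩ := exists_pos_lintegral_lt_of_sigmaFinite lam one_ne_zero
  set h := lowerDensity μ u with hh
  have hhm : Measurable h := measurable_lowerDensity
  set S : Set (E × Measure E) :=
    {q | c q.1 q.2 ≠ 0} ∩ {q | h (q.2 + Measure.dirac q.1) ≤ n} with hS
  have hSm : MeasurableSet S := (hc (measurableSet_singleton 0).compl).inter
    ((hhm.comp measurable_add_dirac) measurableSet_Iic)
  set f : E × Measure E → ENNReal := S.indicator fun q => p q.1 with hf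
  have hfm : Measurable f := (hpm.coe_nnreal_ennreal.comp measurable_fst).indicator hSm
  have hfp : ∀ x ξ, f (x, ξ) ≤ p x := fun x ξ => Set.indicator_le_self _ _ _
  have hfn : ∀ x ξ, h (ξ + Measure.dirac x) * f (x, ξ) ≤ n * p x := by
    intro x ξ
    by_cases hx : (x, ξ) ∈ S
    · exact mul_le_mul' hx.2 (hfp x ξ)
    · simp [f, hx]
  have hfc : ∀ x ξ, c x ξ = 0 → f (x, ξ) = 0 := fun x ξ h0 =>
    Set.indicator_of_notMem (fun hx => hx.1 h0) _
  have hpfin : ∫⁻ x, ∫⁻ _, (p x : ENNReal) ∂μ ∂lam ≠ ⊤ := by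
    simp_rw [lintegral_const]
    rw [lintegral_mul_const _ hpm.coe_nnreal_ennreal]
    exact ENNReal.mul_ne_top (hp.trans_le le_top).ne (measure_ne_top _ _)
  have hfin : ∫⁻ q, f q ∂lam.prod μ ≠ ⊤ := by
    rw [lintegral_prod _ hfm.aemeasurable]
    exact ne_top_of_le_ne_top hpfin (lintegral_mono fun x => lintegral_mono fun ξ => hfp x ξ)
  set g : E → Measure E → ENNReal :=
    fun x => lowerDensity μ fun p => u (p.1, p.2 + Measure.dirac x) with hg
  have hux : ∀ x, Measurable fun q : E × Measure E => u (q.1, q.2 + Measure.dirac x) :=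
    fun x => hu.comp (measurable_shift_const x)
  have hfx : ∀ x, Measurable fun ξ => f (x, ξ) := fun x => hfm.comp measurable_prodMk_left
  have huθ : Measurable fun q : E × Measure E => u (q.1, q.2 + Measure.dirac q.1) * f q :=
    (hu.comp measurable_prodMk_add_dirac).mul hfm
  have hI2 : ∀ x, ∫⁻ ξ, (u (x, ξ + Measure.dirac x) + g x ξ) * f (x, ξ) ∂μ =
      ∫⁻ ξ, u (x, ξ + Measure.dirac x) * f (x, ξ) ∂μ +
        ∫⁻ q, u (q.1, q.2 + Measure.dirac x) * f (x, q.2) ∂campbell lam μ c := by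
    intro x
    simp_rw [add_mul]
    refine (lintegral_add_left (huθ.comp measurable_prodMk_left) _).trans ?_
    congr 1
    simp_rw [mul_comm _ (f _)]
    exact hC.lintegral_mul_lowerDensity (hux x) (hfx x)
  have hle : ∀ x, ∀ᵐ ξ ∂μ, h (ξ + Measure.dirac x) * f (x, ξ) ≤
      (u (x, ξ + Measure.dirac x) + g x ξ) * f (x, ξ) := fun x => by
    filter_upwards [lowerDensity_add_dirac_le hu x] with ξ hξ using mul_le_mul_left hξ _
  have hI2m : Measurable fun x => ∫⁻ ξ, (u (x, ξ + Measure.dirac x) + g x ξ) * f (x, ξ) ∂μ := by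
    simp_rw [hI2]
    refine huθ.lintegral_prod_right'.add ?_
    exact ((hu.comp measurable_shift_snd).mul (measurable_forget hfm)).lintegral_prod_right'
  have key : (fun x => ∫⁻ ξ, h (ξ + Measure.dirac x) * f (x, ξ) ∂μ) =ᵐ[lam]
      fun x => ∫⁻ ξ, (u (x, ξ + Measure.dirac x) + g x ξ) * f (x, ξ) ∂μ := by
    refine ae_eq_of_ae_le_of_lintegral_le (.of_forall fun x => lintegral_mono_ae (hle x)) ?_
      hI2m.aemeasurable ?_
    · refine ne_top_of_le_ne_top (ENNReal.mul_ne_top (ENNReal.natCast_ne_top n) hpfin) ?_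
      rw [← lintegral_const_mul' _ _ (ENNReal.natCast_ne_top n)]
      refine lintegral_mono fun x => ?_
      rw [← lintegral_const_mul' _ _ (ENNReal.natCast_ne_top n)]
      exact lintegral_mono fun ξ => hfn x ξ
    · simp_rw [hI2]
      rw [← lintegral_shiftCampbell hfm hu, ← lintegral_shiftLaw hfm hhm]
      exact lintegral_density_shiftLaw hc hC hfm hfc hfin hu
  filter_upwards [key] with x hx
  have : (fun ξ => h (ξ + Measure.dirac x) * f (x, ξ)) =ᵐ[μ]
      fun ξ => (u (x, ξ + Measure.dirac x) + g x ξ) * f (x, ξ) := by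
    refine ae_eq_of_ae_le_of_lintegral_le (hle x) ?_ ?_ hx.ge
    · refine ne_top_of_le_ne_top ?_ (lintegral_mono fun ξ => hfn x ξ)
      rw [lintegral_const]
      exact ENNReal.mul_ne_top (ENNReal.mul_ne_top (by simp) (by simp)) (measure_ne_top _ _)
    · exact (((hu.comp (measurable_const.prodMk (measurable_add_dirac_const x))).add
        measurable_lowerDensity).mul (hfx x)).aemeasurable
  filter_upwards [this] with ξ hξ hcx hn
  have hfe : f (x, ξ) = p x := Set.indicator_of_mem (s := S) ⟨hcx, hn⟩ _
  simp only [hfe] at hξ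
  exact (ENNReal.mul_left_inj (by simpa using (hp0 x).ne') (by simp)).1 hξ

/-- Adding a typical point `x` to the configuration changes the density of `u` by the value of
`u` at `x`. -/
theorem lowerDensity_add_dirac [IsFiniteMeasure μ] (hc : Measurable (Function.uncurry c))
    (hC : IsCampbell μ (campbell lam μ c)) (hu : Measurable u) :
    ∀ᵐ x ∂lam, ∀ᵐ ξ ∂μ, c x ξ ≠ 0 →
      lowerDensity μ u (ξ + Measure.dirac x) = u (x, ξ + Measure.dirac x) +
        lowerDensity μ (fun p => u (p.1, p.2 + Measure.dirac x)) ξ := by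
  filter_upwards [ae_all_iff.2 fun n => lowerDensity_add_dirac_of_le hc hC hu n] with x hx
  filter_upwards [ae_all_iff.2 hx, lowerDensity_add_dirac_le hu x] with ξ hξ hle hcx
  by_cases h : lowerDensity μ u (ξ + Measure.dirac x) = ⊤
  · rw [h] at hle ⊢
    exact (top_le_iff.1 hle).symm
  · obtain ⟨n, hn⟩ := ENNReal.exists_nat_gt h
    exact hξ n hcx hn.le

end

section

theorem exists_eq_enat_of_forall_notMem_Ioo {r : ENNReal}
    (h : ∀ n : ℕ, ¬ ((n : ENNReal) < r ∧ r < n + 1)) : r = ⊤ ∨ ∃ m : ℕ, r = m := by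
  refine or_iff_not_imp_left.2 fun hr => ?_
  lift r to NNReal using hr
  refine ⟨⌊r⌋₊, ?_⟩
  have h1 := h ⌊r⌋₊
  have h2 : (r : ENNReal) < ⌊r⌋₊ + 1 := by exact_mod_cast Nat.lt_floor_add_one r
  have h3 : ((⌊r⌋₊ : ℕ) : ENNReal) ≤ r := by exact_mod_cast Nat.floor_le zero_le
  exact le_antisymm (not_lt.1 fun h4 => h1 ⟨h4, h2⟩) h3

variable {E : Type*} [MeasurableSpace E] {μ : Measure (Measure E)} [IsFiniteMeasure μ]
  {lam : Measure E} [SigmaFinite lam] {c : E → Measure E → ENNReal}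

theorem measure_eq_zero_of_lowerDensity_pos (hc : Measurable (Function.uncurry c))
    (hC : IsCampbell μ (campbell lam μ c)) {D : Set (E × Measure E)} (hD : MeasurableSet D)
    {s : Set (Measure E)} (hs : MeasurableSet s)
    (hpos : ∀ ξ ∈ s, lowerDensity μ (D.indicator 1) ξ ≠ 0)
    (H : ∀ᵐ x ∂lam, ∀ᵐ ξ ∂μ, c x ξ ≠ 0 → (x, ξ + Measure.dirac x) ∈ D →
      ξ + Measure.dirac x ∉ s) : μ s = 0 := by
  have hDm : Measurable (D.indicator (1 : E × Measure E → ENNReal)) := measurable_one.indicator hD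
  have hsm : Measurable (s.indicator (1 : Measure E → ENNReal)) := measurable_one.indicator hs
  have hm : Measurable fun p : E × Measure E =>
      s.indicator (1 : Measure E → ENNReal) p.2 * D.indicator 1 p :=
    (hsm.comp measurable_snd).mul hDm
  have hm' : Measurable fun p : E × Measure E =>
      s.indicator (1 : Measure E → ENNReal) (p.2 + Measure.dirac p.1) *
        D.indicator 1 (p.1, p.2 + Measure.dirac p.1) * c p.1 p.2 :=
    (hm.comp measurable_prodMk_add_dirac).mul hc
  have h0 : ∫⁻ ξ, s.indicator 1 ξ * lowerDensity μ (D.indicator 1) ξ ∂μ = 0 := by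
    rw [hC.lintegral_mul_lowerDensity hDm hsm, lintegral_campbell hc hm,
      lintegral_prod _ hm'.aemeasurable]
    refine lintegral_eq_zero_of_ae_eq_zero ?_
    filter_upwards [H] with x hx
    refine lintegral_eq_zero_of_ae_eq_zero ?_
    filter_upwards [hx] with ξ hξ
    by_cases h1 : c x ξ = 0
    · simp [h1]
    by_cases h2 : (x, ξ + Measure.dirac x) ∈ D
    · simp [hξ h1 h2]
    · simp [h2]
  have h1 := (lintegral_eq_zero_iff (hsm.mul measurable_lowerDensity)).1 h0
  refine measure_mono_null (fun ξ hξ => ?_) (ae_iff.1 h1)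
  simpa [hξ] using hpos ξ hξ

theorem measure_lowerDensity_mem_Ioo (hc : Measurable (Function.uncurry c))
    (hC : IsCampbell μ (campbell lam μ c)) (n : ℕ) {D : Set (E × Measure E)}
    (hD : MeasurableSet D) :
    μ {ξ | n < lowerDensity μ (D.indicator 1) ξ ∧
      lowerDensity μ (D.indicator 1) ξ < n + 1} = 0 := by
  induction n generalizing D with
  | zero | succ n ih => ?_
  all_goals
    have hDm : Measurable (D.indicator (1 : E × Measure E → ENNReal)) := measurable_one.indicator hD
    refine measure_eq_zero_of_lowerDensity_pos hc hC hD
      (measurable_lowerDensity measurableSet_Ioo) (fun ξ hξ => (pos_of_gt hξ.1).ne') ?_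
    filter_upwards [lowerDensity_add_dirac hc hC hDm] with x hx
  · filter_upwards [hx] with ξ hξ hcx hD' hs
    have h1 : lowerDensity μ (D.indicator 1) (ξ + Measure.dirac x) < 1 := by simpa using hs.2
    rw [hξ hcx, Set.indicator_of_mem hD'] at h1
    exact absurd h1 (by simp)
  · set D' : Set (E × Measure E) := (fun p => (p.1, p.2 + Measure.dirac x)) ⁻¹' D with hD'
    filter_upwards [hx, measure_eq_zero_iff_ae_notMem.1 (ih (measurable_shift_const x hD))]
      with ξ hξ hn hcx hD' hs
    refine hn ?_
    have h1 := hs.1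
    have h2 := hs.2
    rw [hξ hcx, Set.indicator_of_mem hD', Pi.one_apply, Nat.cast_succ, add_comm 1] at h1 h2
    exact ⟨lt_of_add_lt_add_right h1, lt_of_add_lt_add_right h2⟩

/-- The density of an indicator is almost surely a natural number or infinite. -/
theorem ae_lowerDensity_indicator (hc : Measurable (Function.uncurry c))
    (hC : IsCampbell μ (campbell lam μ c)) {D : Set (E × Measure E)} (hD : MeasurableSet D) :
    ∀ᵐ ξ ∂μ, lowerDensity μ (D.indicator 1) ξ = ⊤ ∨
      ∃ m : ℕ, lowerDensity μ (D.indicator 1) ξ = m := by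
  have := ae_all_iff.2 fun n : ℕ =>
    measure_eq_zero_iff_ae_notMem.1 (measure_lowerDensity_mem_Ioo hc hC n hD)
  filter_upwards [this] with ξ hξ using exists_eq_enat_of_forall_notMem_Ioo hξ

end

section

section partition

variable {n : ℕ} (P : Finpartition (Finset.univ : Finset (Fin n)))

/-- The index of the block containing `i`. -/
noncomputable def blockIndex (i : Fin n) : Fin P.parts.card :=
  P.parts.equivFin ⟨P.part i, P.part_mem.2 (mem_univ i)⟩

theorem blockIndex_eq_iff {i j : Fin n} : blockIndex P i = blockIndex P j ↔ i ∈ P.part j := by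
  rw [blockIndex, blockIndex, Equiv.apply_eq_iff_eq, Subtype.mk.injEq]
  exact (P.mem_part_iff_part_eq_part (mem_univ i) (mem_univ j)).symm

theorem mem_blockOf {i : Fin n} {l : Fin P.parts.card} :
    i ∈ blockOf P l ↔ blockIndex P i = l := by
  rw [blockIndex, ← Equiv.eq_symm_apply, Subtype.ext_iff]
  exact (P.part_eq_iff_mem (P.parts.equivFin.symm l).2).symm

theorem blockIndex_surjective : Function.Surjective (blockIndex P) := fun l => by
  obtain ⟨i, hi⟩ := P.nonempty_of_mem_parts (P.parts.equivFin.symm l).2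
  exact ⟨i, (mem_blockOf P).1 hi⟩

theorem prod_blockIndex {M : Type*} [CommMonoid M] (a : Fin P.parts.card → M) :
    ∏ i, a (blockIndex P i) = ∏ l, a l ^ (blockOf P l).card := by
  rw [← Finset.prod_fiberwise univ (blockIndex P)]
  refine Finset.prod_congr rfl fun l _ => ?_
  have : blockOf P l = univ.filter fun i => blockIndex P i = l := by
    ext i; simp [mem_blockOf]
  rw [this, ← prod_const]
  exact Finset.prod_congr rfl fun i hi => by rw [(mem_filter.1 hi).2]

theorem sum_card_blockOf : ∑ l, (blockOf P l).card = n := by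
  have := congrArg Multiplicative.toAdd (prod_blockIndex P fun _ => Multiplicative.ofAdd 1)
  simpa [toAdd_prod] using this.symm

variable {P} in
theorem ext_blockIndex {P' : Finpartition (Finset.univ : Finset (Fin n))}
    (h : ∀ i j, blockIndex P i = blockIndex P j ↔ blockIndex P' i = blockIndex P' j) :
    P = P' := by
  have hp : ∀ i, P.part i = P'.part i := fun i => by
    ext j
    rw [← blockIndex_eq_iff, ← blockIndex_eq_iff, h]
  have hi : ∀ P : Finpartition (Finset.univ : Finset (Fin n)), P.parts = univ.image P.part := by
    intro P
    ext B
    simp only [mem_image, mem_univ, true_and]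
    refine ⟨fun hB => ?_, ?_⟩
    · obtain ⟨i, hi⟩ := P.nonempty_of_mem_parts hB
      exact ⟨i, (P.part_eq_iff_mem hB).2 hi⟩
    · rintro ⟨i, rfl⟩
      exact P.part_mem.2 (mem_univ i)
  refine Finpartition.ext ?_
  rw [hi P, hi P']
  exact image_congr fun i _ => hp i

/-- A function on `Fin n` amounts to the partition into its level sets and an injective choice of
values. -/
theorem bijective_sigma_comp_blockIndex (ι : Type*) :
    Function.Bijective fun p : (Σ P : Finpartition (Finset.univ : Finset (Fin n)),
      {g : Fin P.parts.card → ι // Function.Injective g}) =>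
        fun i => (p.2 : Fin p.1.parts.card → ι) (blockIndex p.1 i) := by
  constructor
  · rintro ⟨P, g, hg⟩ ⟨P', g', hg'⟩ h
    obtain rfl : P = P' := ext_blockIndex fun i j => by
      rw [← hg.eq_iff, ← hg'.eq_iff]
      exact ⟨fun e => (congrFun h i).symm.trans (e.trans (congrFun h j)),
        fun e => (congrFun h i).trans (e.trans (congrFun h j).symm)⟩
    obtain rfl : g = g' := (blockIndex_surjective P).injective_comp_right h
    rfl
  · classical
    intro f
    let P := Finpartition.ofSetoid (Setoid.ker f)
    have hP : ∀ i j, blockIndex P i = blockIndex P j ↔ f i = f j := fun i j => by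
      rw [blockIndex_eq_iff, Finpartition.mem_part_ofSetoid_iff_rel]
      exact eq_comm
    obtain ⟨σ, hσ⟩ := (blockIndex_surjective P).hasRightInverse
    refine ⟨⟨P, f ∘ σ, fun l l' h => ?_⟩, funext fun i => (hP _ _).1 (hσ _)⟩
    rw [← hσ l, ← hσ l']
    exact (hP _ _).2 h

theorem sum_pow_eq_sum_finpartition {ι R : Type*} [Fintype ι] [DecidableEq ι] [CommSemiring R]
    (a : ι → R) (n : ℕ) :
    (∑ p, a p) ^ n = ∑ P : Finpartition (Finset.univ : Finset (Fin n)),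
      ∑ g : {g : Fin P.parts.card → ι // Function.Injective g},
        ∏ l, a (g.1 l) ^ (blockOf P l).card := by
  rw [Fintype.sum_pow, ← (bijective_sigma_comp_blockIndex ι).sum_comp, Fintype.sum_sigma]
  refine Finset.sum_congr rfl fun P _ => Finset.sum_congr rfl fun g _ => ?_
  exact prod_blockIndex P fun l => a (g.1 l)

end partition

section descSum

variable {Q : Type*} [Fintype Q] [DecidableEq Q] (a : Q → ENNReal)

/-- The sum of `∏ l, a (j l) ^ m l` over tuples of distinct individuals, `j l` denoting the type of
the `l`-th one, in a population with `h j` individuals of type `j`. -/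
noncomputable def descSum : (k : ℕ) → (Q → ENNReal) → (Fin k → ℕ) → ENNReal
  | 0, _, _ => 1
  | k + 1, h, m => ∑ j, a j ^ m (Fin.last k) * h j *
      descSum k (h - Pi.single j 1) fun l => m l.castSucc

theorem measurable_descSum (k : ℕ) (m : Fin k → ℕ) : Measurable fun h => descSum a k h m := by
  induction k with
  | zero => exact measurable_const
  | succ k ih =>
    refine Finset.measurable_sum _ fun j _ => ?_
    refine (measurable_const.mul (measurable_pi_apply j)).mul ?_
    exact (ih _).comp (measurable_id.sub_const _)

theorem descSum_card {ι : Type*} [Fintype ι] [DecidableEq ι] (q : ι → Q) (k : ℕ) (S : Finset ι)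
    (m : Fin k → ℕ) :
    descSum a k (fun j => ((S.filter fun p => q p = j).card : ENNReal)) m =
      ∑ g : Fin k → ι, if Function.Injective g ∧ ∀ l, g l ∈ S then
        ∏ l, a (q (g l)) ^ m l else 0 := by
  induction k generalizing S with
  | zero => simp [descSum, Function.injective_of_subsingleton]
  | succ k ih =>
    have he : ∀ p ∈ S, (fun j => ((S.filter fun p => q p = j).card : ENNReal)) -
        Pi.single (q p) 1 = fun j => (((S.erase p).filter fun p => q p = j).card : ENNReal) := by
      intro p hp
      ext j
      rw [Pi.sub_apply, filter_erase]
      by_cases h : q p = j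
      · subst h
        rw [card_erase_of_mem (by simp [hp])]
        simp
      · rw [erase_eq_of_notMem (by simp [h]), Pi.single_eq_of_ne' h, tsub_zero]
    rw [descSum, ← (Fin.snocEquiv fun _ => ι).sum_comp, Fintype.sum_prod_type]
    trans ∑ p ∈ S, a (q p) ^ m (Fin.last k) * descSum a k
      (fun j => (((S.erase p).filter fun p => q p = j).card : ENNReal)) fun l => m l.castSucc
    · rw [← Finset.sum_fiberwise S q]
      refine Finset.sum_congr rfl fun j _ => ?_
      rw [mul_right_comm, mul_comm, ← nsmul_eq_mul, ← sum_const]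
      refine Finset.sum_congr rfl fun p hp => ?_
      obtain ⟨hpS, rfl⟩ := mem_filter.1 hp
      rw [← he p hpS]
    · rw [← Finset.sum_subset (subset_univ S)]
      · refine Finset.sum_congr rfl fun p hp => ?_
        rw [ih, mul_sum]
        refine Finset.sum_congr rfl fun g _ => ?_
        have : (Function.Injective ((Fin.snocEquiv fun _ => ι) (p, g)) ∧
            ∀ l, (Fin.snocEquiv fun _ => ι) (p, g) l ∈ S) ↔
            (Function.Injective g ∧ ∀ l, g l ∈ S.erase p) := by
          change Function.Injective (Fin.snoc g p : Fin (k + 1) → ι) ∧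
            (∀ l, (Fin.snoc g p : Fin (k + 1) → ι) l ∈ S) ↔ _
          simp only [Fin.snoc_injective_iff, Fin.forall_fin_succ', Fin.snoc_castSucc,
            Fin.snoc_last, mem_erase, Set.mem_range, not_exists, forall_and, hp, and_true]
          tauto
        simp only [this, mul_ite, mul_zero, Fin.prod_univ_castSucc]
        simp [mul_comm]
      · intro p _ hp
        refine Finset.sum_eq_zero fun g _ => if_neg fun h => hp ?_
        simpa using h.2 (Fin.last k)

end descSum

end

section

/-- The sequence `f` is monotone with supremum `L`. -/
def IncreasesTo (f : ℕ → ENNReal) (L : ENNReal) : Prop := Monotone f ∧ ⨆ n, f n = L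

namespace IncreasesTo

variable {f g : ℕ → ENNReal} {L M : ENNReal}

theorem const (L : ENNReal) : IncreasesTo (fun _ => L) L := ⟨monotone_const, iSup_const⟩

theorem mul (hf : IncreasesTo f L) (hg : IncreasesTo g M) :
    IncreasesTo (fun n => f n * g n) (L * M) := by
  refine ⟨hf.1.mul' hg.1, le_antisymm (iSup_le fun n => ?_) ?_⟩
  · rw [← hf.2, ← hg.2]
    exact mul_le_mul' (le_iSup f n) (le_iSup g n)
  · rw [← hf.2, ← hg.2, ENNReal.iSup_mul]
    refine iSup_le fun i => ?_
    rw [ENNReal.mul_iSup]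
    refine iSup_le fun j => le_iSup_of_le (max i j) ?_
    exact mul_le_mul' (hf.1 (le_max_left i j)) (hg.1 (le_max_right i j))

theorem add (hf : IncreasesTo f L) (hg : IncreasesTo g M) :
    IncreasesTo (fun n => f n + g n) (L + M) :=
  ⟨hf.1.add hg.1, by rw [← hf.2, ← hg.2, ENNReal.iSup_add_iSup_of_monotone hf.1 hg.1]⟩

theorem sum {ι : Type*} (s : Finset ι) {f : ι → ℕ → ENNReal} {L : ι → ENNReal}
    (h : ∀ i ∈ s, IncreasesTo (f i) (L i)) :
    IncreasesTo (fun n => ∑ i ∈ s, f i n) (∑ i ∈ s, L i) := by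
  classical
  induction s using Finset.induction with
  | empty => simpa using const 0
  | insert i s hi ih =>
    simp only [sum_insert hi]
    exact (h i (mem_insert_self _ _)).add (ih fun j hj => h j (mem_insert_of_mem hj))

theorem prod {ι : Type*} (s : Finset ι) {f : ι → ℕ → ENNReal} {L : ι → ENNReal}
    (h : ∀ i ∈ s, IncreasesTo (f i) (L i)) :
    IncreasesTo (fun n => ∏ i ∈ s, f i n) (∏ i ∈ s, L i) := by
  classical
  induction s using Finset.induction with
  | empty => simpa using const 1
  | insert i s hi ih =>
    simp only [prod_insert hi]
    exact (h i (mem_insert_self _ _)).mul (ih fun j hj => h j (mem_insert_of_mem hj))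

theorem pow (hf : IncreasesTo f L) (k : ℕ) : IncreasesTo (fun n => f n ^ k) (L ^ k) := by
  simpa using prod (range k) fun _ _ => hf

theorem sub_const (hf : IncreasesTo f L) (a : ENNReal) :
    IncreasesTo (fun n => f n - a) (L - a) :=
  ⟨fun _ _ h => tsub_le_tsub_right (hf.1 h) a, by rw [← ENNReal.iSup_sub, hf.2]⟩

theorem unique (hf : IncreasesTo f L) (hf' : IncreasesTo f M) : L = M := hf.2.symm.trans hf'.2

end IncreasesTo

section descSum

variable {Q : Type*} [Fintype Q] [DecidableEq Q] (a : Q → ENNReal)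

theorem IncreasesTo.descSum {h : ℕ → Q → ENNReal} {H : Q → ENNReal}
    (hh : ∀ j, IncreasesTo (fun n => h n j) (H j)) (k : ℕ) (m : Fin k → ℕ) :
    IncreasesTo (fun n => descSum a k (h n) m) (descSum a k H m) := by
  induction k generalizing h H with
  | zero => exact .const 1
  | succ k ih =>
    refine IncreasesTo.sum _ fun j _ => ((IncreasesTo.const _).mul (hh j)).mul ?_
    exact ih (fun i => (hh i).sub_const _) _

theorem sum_pow_eq_sum_descSum_natCast (h : Q → ℕ) (n : ℕ) :
    (∑ j, a j * h j) ^ n = ∑ P : Finpartition (Finset.univ : Finset (Fin n)),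
      descSum a P.parts.card (fun j => (h j : ENNReal)) fun l => (blockOf P l).card := by
  have h1 : ∑ j, a j * h j = ∑ p : Σ j, Fin (h j), a p.1 := by
    simp [Fintype.sum_sigma, mul_comm]
  have h2 : (fun j => (h j : ENNReal)) = fun j =>
      (((univ : Finset (Σ j, Fin (h j))).filter fun p => p.1 = j).card : ENNReal) := by
    funext j
    have : (univ.filter fun p : Σ j, Fin (h j) => p.1 = j) =
        univ.map (Function.Embedding.sigmaMk (β := fun j => Fin (h j)) j) := by
      ext ⟨i, x⟩
      simp only [mem_filter, mem_univ, true_and, mem_map, Function.Embedding.sigmaMk_apply]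
      refine ⟨?_, ?_⟩
      · rintro rfl
        exact ⟨x, rfl⟩
      · rintro ⟨y, hy⟩
        exact (congrArg Sigma.fst hy).symm
    rw [this, card_map, card_univ, Fintype.card_fin]
  rw [h1, sum_pow_eq_sum_finpartition]
  refine Finset.sum_congr rfl fun P _ => ?_
  rw [h2, descSum_card]
  simp only [mem_univ, implies_true, and_true]
  rw [← sum_filter]
  exact (Finset.sum_subtype (univ.filter Function.Injective) (p := Function.Injective)
    (fun g => by simp)
    fun g : Fin P.parts.card → Σ j, Fin (h j) => ∏ l, a (g l).1 ^ (blockOf P l).card).symm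

theorem sum_pow_eq_sum_descSum (h : Q → ENNReal) (hh : ∀ j, h j = ⊤ ∨ ∃ m : ℕ, h j = m) (n : ℕ) :
    (∑ j, a j * h j) ^ n = ∑ P : Finpartition (Finset.univ : Finset (Fin n)),
      descSum a P.parts.card h fun l => (blockOf P l).card := by
  have H : ∀ j, ∃ f : ℕ → ℕ, IncreasesTo (fun N => (f N : ENNReal)) (h j) := by
    intro j
    rcases hh j with hj | ⟨m, hj⟩
    · refine ⟨id, fun _ _ h => Nat.cast_le.2 h, ?_⟩
      rw [hj]; exact ENNReal.iSup_natCast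
    · exact ⟨fun _ => m, hj ▸ .const _⟩
  choose f hf using H
  have h1 := (IncreasesTo.sum univ fun j _ => (IncreasesTo.const (a j)).mul (hf j)).pow n
  refine h1.unique ?_
  simp only [sum_pow_eq_sum_descSum_natCast]
  exact IncreasesTo.sum _ fun P _ => IncreasesTo.descSum a hf _ _

end descSum

end

section

variable {E : Type*} [MeasurableSpace E]

theorem measurable_add_sum_dirac {k : ℕ} (s : Finset (Fin k)) :
    Measurable fun p : Measure E × (Fin k → E) => p.1 + ∑ l ∈ s, Measure.dirac (p.2 l) :=
  measurable_fst.add <| Finset.measurable_sum _ fun l _ =>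
    Measure.measurable_dirac.comp ((measurable_pi_apply l).comp measurable_snd)

/-- The integrand of the `k`-th order multivariate Mecke type formula. -/
noncomputable def tupleIntegrand (c : E → Measure E → ENNReal) (F : Measure E → ENNReal)
    (u : E × Measure E → ENNReal) {k : ℕ} (m : Fin k → ℕ) (ξ : Measure E) (x : Fin k → E) :
    ENNReal :=
  F (ξ + ∑ l, Measure.dirac (x l)) *
    (∏ l, u (x l, ξ + ∑ l', Measure.dirac (x l')) ^ m l) * chat c x ξ

section

variable {c : E → Measure E → ENNReal} {F : Measure E → ENNReal} {u : E × Measure E → ENNReal}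

theorem measurable_tupleIntegrand (hc : Measurable (Function.uncurry c)) (hF : Measurable F)
    (hu : Measurable u) {k : ℕ} (m : Fin k → ℕ) :
    Measurable (Function.uncurry (tupleIntegrand c F u m)) := by
  have hx (l : Fin k) : Measurable fun p : Measure E × (Fin k → E) => p.2 l :=
    (measurable_pi_apply l).comp measurable_snd
  refine ((hF.comp (measurable_add_sum_dirac univ)).mul ?_).mul ?_
  · refine Finset.measurable_prod _ fun l _ => Measurable.pow_const ?_ _
    exact hu.comp ((hx l).prodMk (measurable_add_sum_dirac univ))
  · refine Finset.measurable_prod _ fun l _ => ?_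
    exact hc.comp ((hx l).prodMk (measurable_add_sum_dirac _))

theorem chat_snoc (c : E → Measure E → ENNReal) {k : ℕ} (y : Fin k → E) (x : E) (ξ : Measure E) :
    chat c (Fin.snoc y x : Fin (k + 1) → E) ξ =
      chat c y ξ * c x (ξ + ∑ l, Measure.dirac (y l)) := by
  rw [chat, Fin.prod_univ_castSucc]
  congr 1
  · refine Finset.prod_congr rfl fun l _ => ?_
    rw [Fin.snoc_castSucc]
    congr 2
    rw [sum_filter, sum_filter, Fin.sum_univ_castSucc]
    simp [Fin.snoc_castSucc, Fin.castSucc_lt_castSucc_iff, not_lt.2 (Fin.castSucc_lt_last l).le]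
  · rw [Fin.snoc_last]
    congr 2
    rw [sum_filter, Fin.sum_univ_castSucc]
    simp [Fin.castSucc_lt_last]

theorem tupleIntegrand_snoc {k : ℕ} (m : Fin (k + 1) → ℕ) (ξ : Measure E) (y : Fin k → E) (x : E) :
    tupleIntegrand c F u m ξ (Fin.snoc y x : Fin (k + 1) → E) =
      tupleIntegrand c
        (fun η => F (η + Measure.dirac x) * u (x, η + Measure.dirac x) ^ m (Fin.last k) * c x η)
        (fun p => u (p.1, p.2 + Measure.dirac x)) (fun l => m l.castSucc) ξ y := by
  have : ξ + ∑ l, Measure.dirac ((Fin.snoc y x : Fin (k + 1) → E) l) =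
      ξ + ∑ l, Measure.dirac (y l) + Measure.dirac x := by
    simp [Fin.sum_univ_castSucc, add_assoc]
  rw [tupleIntegrand, this, chat_snoc, Fin.prod_univ_castSucc]
  simp only [Fin.snoc_castSucc, Fin.snoc_last, tupleIntegrand]
  ring

end

/-- The integral of the right-hand side of the `k`-th order multivariate Mecke type formula. -/
noncomputable def tupleIntegral (lam : Measure E) (μ : Measure (Measure E))
    (c : E → Measure E → ENNReal) (F : Measure E → ENNReal)
    (u : E × Measure E → ENNReal) {k : ℕ} (m : Fin k → ℕ) : ENNReal :=
  ∫⁻ ξ, ∫⁻ x, tupleIntegrand c F u m ξ x ∂(Measure.pi fun _ => lam) ∂μ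

variable {lam : Measure E} {μ : Measure (Measure E)}
  {c : E → Measure E → ENNReal} {F : Measure E → ENNReal} {u : E × Measure E → ENNReal}

theorem tupleIntegral_zero (m : Fin 0 → ℕ) : tupleIntegral lam μ c F u m = ∫⁻ ξ, F ξ ∂μ := by
  refine lintegral_congr fun ξ => ?_
  rw [Measure.pi_of_empty (fun _ => lam) finZeroElim, lintegral_dirac]
  simp [tupleIntegrand, chat]

theorem tupleIntegral_succ [SigmaFinite lam] [SFinite μ]
    (hc : Measurable (Function.uncurry c)) (hF : Measurable F)
    (hu : Measurable u) {k : ℕ} (m : Fin (k + 1) → ℕ) :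
    tupleIntegral lam μ c F u m = ∫⁻ x, tupleIntegral lam μ c
        (fun η => F (η + Measure.dirac x) * u (x, η + Measure.dirac x) ^ m (Fin.last k) * c x η)
        (fun p => u (p.1, p.2 + Measure.dirac x)) (fun l => m l.castSucc) ∂lam := by
  have hm := measurable_tupleIntegrand hc hF hu m
  have hs : Measurable fun p : (Measure E × E) × (Fin k → E) =>
      (p.1.1, (Fin.snoc p.2 p.1.2 : Fin (k + 1) → E)) := by
    refine (measurable_fst.comp measurable_fst).prodMk (measurable_pi_iff.2 fun l => ?_)
    refine Fin.lastCases ?_ (fun l => ?_) l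
    · simp only [Fin.snoc_last]
      exact measurable_snd.comp measurable_fst
    · simp only [Fin.snoc_castSucc]
      exact (measurable_pi_apply l).comp measurable_snd
  have hms : Measurable fun p : Measure E × E => ∫⁻ y : Fin k → E,
      tupleIntegrand c F u m p.1 (Fin.snoc y p.2 : Fin (k + 1) → E) ∂(Measure.pi fun _ => lam) :=
    (hm.comp hs).lintegral_prod_right'
  trans ∫⁻ ξ, ∫⁻ x, ∫⁻ y : Fin k → E, tupleIntegrand c F u m ξ (Fin.snoc y x : Fin (k + 1) → E)
      ∂(Measure.pi fun _ => lam) ∂lam ∂μ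
  · refine lintegral_congr fun ξ => ?_
    have hmp := (measurePreserving_piFinSuccAbove (fun _ : Fin (k + 1) => lam) (Fin.last k)).symm
    have hmξ : Measurable fun x => tupleIntegrand c F u m ξ x := hm.comp measurable_prodMk_left
    rw [← hmp.lintegral_comp hmξ]
    have hme : Measurable fun p : E × (Fin k → E) =>
        tupleIntegrand c F u m ξ (Fin.snoc p.2 p.1 : Fin (k + 1) → E) :=
      hm.comp (hs.comp ((measurable_const.prodMk measurable_fst).prodMk measurable_snd))
    refine Eq.trans ?_ (lintegral_prod _ hme.aemeasurable)
    refine lintegral_congr fun p => ?_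
    congr 1
    exact Fin.insertNth_last' _ _
  · rw [lintegral_lintegral_swap hms.aemeasurable]
    simp only [tupleIntegrand_snoc]
    rfl

end

section

variable {E : Type*} [MeasurableSpace E] {lam : Measure E} [SigmaFinite lam]
  {μ : Measure (Measure E)} [IsFiniteMeasure μ] {c : E → Measure E → ENNReal}

section simple

variable {Q : Type*}

/-- The number of particles of each type, for a classification of particles by `q`. -/
noncomputable def typeCount (μ : Measure (Measure E)) [SFinite μ] (q : E × Measure E → Q)
    (ξ : Measure E) (j : Q) : ENNReal :=
  lowerDensity μ ((q ⁻¹' {j}).indicator 1) ξ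

theorem measurable_typeCount (q : E × Measure E → Q) : Measurable (typeCount μ q) :=
  measurable_pi_iff.2 fun _ => measurable_lowerDensity

variable [MeasurableSpace Q] [MeasurableSingletonClass Q] [Fintype Q] [DecidableEq Q]

theorem typeCount_add_dirac_sub (hc : Measurable (Function.uncurry c))
    (hC : IsCampbell μ (campbell lam μ c)) {q : E × Measure E → Q} (hq : Measurable q) :
    ∀ᵐ x ∂lam, ∀ᵐ ξ ∂μ, c x ξ ≠ 0 →
      typeCount μ (fun p => q (p.1, p.2 + Measure.dirac x)) ξ =
        typeCount μ q (ξ + Measure.dirac x) - Pi.single (q (x, ξ + Measure.dirac x)) 1 := by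
  have h := ae_all_iff.2 fun j => lowerDensity_add_dirac hc hC
    (measurable_one.indicator (hq (measurableSet_singleton j)) :
      Measurable ((q ⁻¹' {j}).indicator (1 : E × Measure E → ENNReal)))
  filter_upwards [h] with x hx
  filter_upwards [ae_all_iff.2 hx] with ξ hξ hcx
  ext j
  have hj : typeCount μ q (ξ + Measure.dirac x) j = _ := hξ j hcx
  rw [Pi.sub_apply, hj]
  by_cases hqj : q (x, ξ + Measure.dirac x) = j
  · rw [Set.indicator_of_mem (by exact hqj), Pi.one_apply, hqj, Pi.single_eq_same,
      ENNReal.add_sub_cancel_left ENNReal.one_ne_top]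
    rfl
  · rw [Set.indicator_of_notMem (by exact hqj), Pi.single_eq_of_ne' hqj, zero_add, tsub_zero]
    rfl

theorem tupleIntegral_comp (hc : Measurable (Function.uncurry c))
    (hC : IsCampbell μ (campbell lam μ c)) (a : Q → ENNReal) {q : E × Measure E → Q}
    (hq : Measurable q) {F : Measure E → ENNReal} (hF : Measurable F) {k : ℕ} (m : Fin k → ℕ) :
    tupleIntegral lam μ c F (a ∘ q) m = ∫⁻ ξ, F ξ * descSum a k (typeCount μ q ξ) m ∂μ := by
  have ha : Measurable a := measurable_of_finite a
  induction k generalizing F q with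
  | zero => simp [tupleIntegral_zero, descSum]
  | succ k ih =>
    have hcx (x : E) : Measurable (c x) := hc.comp measurable_prodMk_left
    have hFx (x : E) : Measurable fun η => F (η + Measure.dirac x) *
        (a ∘ q) (x, η + Measure.dirac x) ^ m (Fin.last k) * c x η := by
      refine ((hF.comp (measurable_add_dirac_const x)).mul (Measurable.pow_const ?_ _)).mul (hcx x)
      exact (ha.comp hq).comp (measurable_const.prodMk (measurable_add_dirac_const x))
    have hdesc (j : Q) : Measurable fun ξ =>
        descSum a k (typeCount μ q ξ - Pi.single j 1) fun l => m l.castSucc :=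
      (measurable_descSum a k _).comp ((measurable_typeCount q).sub_const _)
    have hind (j : Q) : Measurable ((q ⁻¹' {j}).indicator (1 : E × Measure E → ENNReal)) :=
      measurable_one.indicator (hq (measurableSet_singleton j))
    have hG (j : Q) : Measurable fun ξ => F ξ * (a j ^ m (Fin.last k) *
        descSum a k (typeCount μ q ξ - Pi.single j 1) fun l => m l.castSucc) :=
      hF.mul ((hdesc j).const_mul _)
    have hGi (j : Q) : Measurable fun p : E × Measure E => F p.2 * (a j ^ m (Fin.last k) *
        descSum a k (typeCount μ q p.2 - Pi.single j 1) fun l => m l.castSucc) *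
          (q ⁻¹' {j}).indicator 1 p :=
      ((hG j).comp measurable_snd).mul (hind j)
    let W : E × Measure E → ENNReal := fun p => ∑ j, F p.2 * (a j ^ m (Fin.last k) *
        descSum a k (typeCount μ q p.2 - Pi.single j 1) fun l => m l.castSucc) *
          (q ⁻¹' {j}).indicator 1 p
    have hW : Measurable W := Finset.measurable_sum _ fun j _ => hGi j
    have hWq (p) : W p = F p.2 * (a (q p) ^ m (Fin.last k) *
        descSum a k (typeCount μ q p.2 - Pi.single (q p) 1) fun l => m l.castSucc) := by
      refine (Finset.sum_eq_single_of_mem (q p) (mem_univ _) fun j _ hj => ?_).trans ?_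
      · rw [Set.indicator_of_notMem (by exact fun h => hj h.symm), mul_zero]
      · rw [Set.indicator_of_mem (by exact rfl), Pi.one_apply, mul_one]
    rw [tupleIntegral_succ hc hF (ha.comp hq)]
    trans ∫⁻ x, ∫⁻ ξ, W (x, ξ + Measure.dirac x) * c x ξ ∂μ ∂lam
    · refine lintegral_congr_ae ?_
      filter_upwards [typeCount_add_dirac_sub hc hC hq] with x hx
      refine (ih (hq.comp (measurable_shift_const x)) (hFx x) _).trans (lintegral_congr_ae ?_)
      filter_upwards [hx] with ξ hξ
      by_cases h0 : c x ξ = 0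
      · simp [h0]
      · rw [hWq, ← hξ h0]
        simp only [Function.comp_apply]
        change _ * descSum a k (typeCount μ (fun p => q (p.1, p.2 + Measure.dirac x)) ξ) _ = _
        ring
    · have hWc : Measurable fun p : E × Measure E =>
          W (p.1, p.2 + Measure.dirac p.1) * c p.1 p.2 :=
        (hW.comp measurable_prodMk_add_dirac).mul hc
      refine (lintegral_prod _ hWc.aemeasurable).symm.trans
        ((lintegral_campbell hc hW).symm.trans ?_)
      rw [lintegral_finsetSum _ fun j _ => hGi j]
      simp only [descSum, mul_sum]
      rw [lintegral_finsetSum _ fun j _ => ?_]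
      · refine Finset.sum_congr rfl fun j _ => ?_
        refine (hC.lintegral_mul_lowerDensity (hind j) (hG j)).symm.trans
          (lintegral_congr fun ξ => ?_)
        rw [typeCount]
        ring
      · exact hF.mul (((measurable_typeCount q).eval (a := j) |>.const_mul _).mul (hdesc j))

end simple

end

section

variable {E : Type*} [MeasurableSpace E]

theorem IncreasesTo.lintegral {α : Type*} [MeasurableSpace α] {ν : Measure α}
    {f : ℕ → α → ENNReal} {L : α → ENNReal} (hf : ∀ n, Measurable (f n))
    (h : ∀ᵐ x ∂ν, IncreasesTo (fun n => f n x) (L x)) :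
    IncreasesTo (fun n => ∫⁻ x, f n x ∂ν) (∫⁻ x, L x ∂ν) := by
  refine ⟨fun m n hmn => lintegral_mono_ae (h.mono fun x hx => hx.1 hmn), ?_⟩
  rw [← lintegral_iSup' (fun n => (hf n).aemeasurable) (h.mono fun x hx => hx.1)]
  exact lintegral_congr_ae (h.mono fun x hx => hx.2)

theorem lintegral_pow_lowerDensity {μ : Measure (Measure E)} [SigmaFinite μ]
    (w : E × Measure E → ENNReal) {n : ℕ} (hn : n ≠ 0) :
    ∫⁻ ξ, (∫⁻ y, w (y, ξ) ∂ξ) ^ n ∂μ = ∫⁻ ξ, lowerDensity μ w ξ ^ n ∂μ := by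
  refine le_antisymm ?_ (lintegral_mono fun ξ => pow_le_pow_left' (lowerDensity_le ξ) n)
  obtain ⟨f, hf, hle, heq⟩ :=
    exists_measurable_le_lintegral_eq μ fun ξ => (∫⁻ y, w (y, ξ) ∂ξ) ^ n
  have hn' : (n : ℝ) ≠ 0 := Nat.cast_ne_zero.2 hn
  have hfp (ξ : Measure E) : (f ξ ^ (n : ℝ)⁻¹) ^ n = f ξ := by
    rw [← ENNReal.rpow_natCast, ENNReal.rpow_inv_rpow hn']
  rw [heq]
  refine lintegral_mono_ae ?_
  filter_upwards [IsCampbell.le_lowerDensity_ae (μ := μ) (w := w) (hf.pow_const (n : ℝ)⁻¹)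
    fun ξ => (ENNReal.pow_le_pow_left_iff hn).1 ((hfp ξ).trans_le (hle ξ))] with ξ hξ
  rw [← hfp ξ]
  exact pow_le_pow_left' hξ n

section

variable {lam : Measure E} [SigmaFinite lam] {c : E → Measure E → ENNReal}
  {μ : Measure (Measure E)}

theorem IsCampbell.lowerDensity_simpleFunc [SigmaFinite μ] {C : Measure (E × Measure E)}
    (hC : IsCampbell μ C) {Q : Type*} [Fintype Q] [MeasurableSpace Q]
    [MeasurableSingletonClass Q] (a : Q → ENNReal) {q : E × Measure E → Q} (hq : Measurable q) :
    (fun ξ => ∑ j, a j * typeCount μ q ξ j) =ᵐ[μ] lowerDensity μ (a ∘ q) := by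
  have hind (j : Q) : Measurable ((q ⁻¹' {j}).indicator (1 : E × Measure E → ENNReal)) :=
    measurable_one.indicator (hq (measurableSet_singleton j))
  have ht (j : Q) : Measurable fun ξ => typeCount μ q ξ j := measurable_lowerDensity
  refine hC.ae_eq_lowerDensity ((measurable_of_finite a).comp hq)
    (Finset.measurable_sum _ fun j _ => (ht j).const_mul _) fun s hs => ?_
  rw [lintegral_finsetSum _ fun j _ => (ht j).const_mul _]
  trans ∑ j, ∫⁻ p in Prod.snd ⁻¹' s, a j * (q ⁻¹' {j}).indicator 1 p ∂C
  · refine Finset.sum_congr rfl fun j _ => ?_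
    rw [lintegral_const_mul _ (ht j), lintegral_const_mul _ (hind j),
      ← hC.setLIntegral_lowerDensity (hind j) hs]
    rfl
  · rw [← lintegral_finsetSum _ fun j _ => (hind j).const_mul _]
    refine lintegral_congr fun p => ?_
    refine (Finset.sum_eq_single_of_mem (q p) (mem_univ _) fun j _ hj => ?_).trans ?_
    · rw [Set.indicator_of_notMem (by exact fun h => hj h.symm), mul_zero]
    · rw [Set.indicator_of_mem (by exact rfl), Pi.one_apply, mul_one, Function.comp_apply]

theorem lintegral_lowerDensity_pow_simpleFunc [IsFiniteMeasure μ]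
    (hc : Measurable (Function.uncurry c)) (hC : IsCampbell μ (campbell lam μ c))
    (f : SimpleFunc (E × Measure E) ENNReal) (n : ℕ) :
    ∫⁻ ξ, lowerDensity μ f ξ ^ n ∂μ = ∑ P : Finpartition (Finset.univ : Finset (Fin n)),
      tupleIntegral lam μ c 1 f fun l => (blockOf P l).card := by
  let q : E × Measure E → {x // x ∈ f.range} := fun p => ⟨f p, f.mem_range_self p⟩
  let a : {x // x ∈ f.range} → ENNReal := Subtype.val
  have hq : Measurable q := f.measurable.subtype_mk
  have hfq : (f : E × Measure E → ENNReal) = a ∘ q := rfl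
  have hind := ae_all_iff.2 fun j : {x // x ∈ f.range} =>
    ae_lowerDensity_indicator hc hC (hq (measurableSet_singleton j))
  simp only [hfq, tupleIntegral_comp hc hC a hq measurable_one, Pi.one_apply, one_mul]
  have hm (P : Finpartition (Finset.univ : Finset (Fin n))) : Measurable fun ξ =>
      descSum a P.parts.card (typeCount μ q ξ) fun l => (blockOf P l).card :=
    (measurable_descSum a _ _).comp (measurable_typeCount q)
  rw [← lintegral_finsetSum _ fun P _ => hm P]
  refine lintegral_congr_ae ?_
  filter_upwards [hind, hC.lowerDensity_simpleFunc a hq] with ξ h1 h2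
  rw [← h2]
  exact sum_pow_eq_sum_descSum a (typeCount μ q ξ) h1 n

theorem IsCampbell.increasesTo_lowerDensity [SigmaFinite μ] {C : Measure (E × Measure E)}
    (hC : IsCampbell μ C) {w : ℕ → E × Measure E → ENNReal} {u : E × Measure E → ENNReal}
    (hw : ∀ N, Measurable (w N)) (hu : Measurable u)
    (h : ∀ p, IncreasesTo (fun N => w N p) (u p)) :
    ∀ᵐ ξ ∂μ, IncreasesTo (fun N => lowerDensity μ (w N) ξ) (lowerDensity μ u ξ) := by
  have hmono : ∀ᵐ ξ ∂μ, Monotone fun N => lowerDensity μ (w N) ξ := by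
    have := ae_all_iff.2 fun N : ℕ => IsCampbell.le_lowerDensity_ae (μ := μ) (w := w (N + 1))
      (measurable_lowerDensity (μ := μ) (w := w N)) fun ξ => (lowerDensity_le ξ).trans
        (lintegral_mono fun y => (h (y, ξ)).1 N.le_succ)
    exact this.mono fun ξ hξ => monotone_nat_of_le_succ hξ
  have hsup : (fun ξ => ⨆ N, lowerDensity μ (w N) ξ) =ᵐ[μ] lowerDensity μ u := by
    refine hC.ae_eq_lowerDensity hu (.iSup fun N => measurable_lowerDensity) fun s hs => ?_
    rw [lintegral_iSup' (fun N => measurable_lowerDensity.aemeasurable) (ae_restrict_of_ae hmono)]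
    simp only [hC.setLIntegral_lowerDensity (hw _) hs]
    exact (IncreasesTo.lintegral hw (.of_forall h)).2
  filter_upwards [hmono, hsup] with ξ h1 h2 using ⟨h1, h2⟩

theorem IncreasesTo.tupleIntegral [SFinite μ] (hc : Measurable (Function.uncurry c))
    {w : ℕ → E × Measure E → ENNReal} {u : E × Measure E → ENNReal}
    (hw : ∀ N, Measurable (w N)) (h : ∀ p, IncreasesTo (fun N => w N p) (u p))
    {F : Measure E → ENNReal} (hF : Measurable F) {k : ℕ} (m : Fin k → ℕ) :
    IncreasesTo (fun N => tupleIntegral lam μ c F (w N) m) (tupleIntegral lam μ c F u m) := by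
  have hm (N : ℕ) := measurable_tupleIntegrand hc hF (hw N) m
  refine IncreasesTo.lintegral (fun N => (hm N).lintegral_prod_right') (.of_forall fun ξ => ?_)
  refine IncreasesTo.lintegral (fun N => (hm N).comp measurable_prodMk_left)
    (.of_forall fun x => ?_)
  exact ((IncreasesTo.const _).mul (IncreasesTo.prod _ fun l _ => (h _).pow _)).mul
    (IncreasesTo.const _)

theorem lintegral_lowerDensity_pow [IsFiniteMeasure μ]
    (hc : Measurable (Function.uncurry c)) (hC : IsCampbell μ (campbell lam μ c))
    {u : E × Measure E → ENNReal} (hu : Measurable u) (n : ℕ) :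
    ∫⁻ ξ, lowerDensity μ u ξ ^ n ∂μ = ∑ P : Finpartition (Finset.univ : Finset (Fin n)),
      tupleIntegral lam μ c 1 u fun l => (blockOf P l).card := by
  have h (p : E × Measure E) : IncreasesTo (fun N => SimpleFunc.eapprox u N p) (u p) :=
    ⟨fun _ _ hmn => SimpleFunc.monotone_eapprox u hmn p, SimpleFunc.iSup_eapprox_apply hu p⟩
  have hw (N : ℕ) : Measurable (SimpleFunc.eapprox u N) := (SimpleFunc.eapprox u N).measurable
  have h1 : IncreasesTo (fun N => ∫⁻ ξ, lowerDensity μ (SimpleFunc.eapprox u N) ξ ^ n ∂μ) _ :=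
    IncreasesTo.lintegral (fun N => measurable_lowerDensity.pow_const n)
      ((hC.increasesTo_lowerDensity hw hu h).mono fun ξ hξ => hξ.pow n)
  refine h1.unique ?_
  simp only [lintegral_lowerDensity_pow_simpleFunc hc hC]
  exact IncreasesTo.sum _ fun P _ => IncreasesTo.tupleIntegral hc hw h measurable_one _

end

end

end MomentFormula

open MomentFormula

/-- Moment formula (Corollary 3.3): for a point process `μ` with Papangelou intensity `c`,
`∫ F(ξ) (∫ u(y,ξ) ξ(dy))^n μ(dξ)
  = ∑_{k=1}^n ∑_{𝒫 ∈ 𝒯_n^k} ∫_X ∫_{E^k} F(ξ+Δ) ∏_l u(x_l,ξ+Δ)^{|P_l|} ĉ(x,ξ) λ^k(dx) μ(dξ)`. -/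
theorem moment_formula_power
    {E : Type*} [MeasurableSpace E] (lam : Measure E) [SigmaFinite lam]
    (μ : Measure (Measure E)) [IsProbabilityMeasure μ]
    (c : E → Measure E → ENNReal) (hc : Measurable (Function.uncurry c))
    (hGNZ : ∀ w : E → Measure E → ENNReal, Measurable (Function.uncurry w) →
      ∫⁻ ξ, (∫⁻ x, w x ξ ∂ξ) ∂μ
        = ∫⁻ ξ, ∫⁻ x, w x (ξ + Measure.dirac x) * c x ξ ∂lam ∂μ)
    (n : ℕ) (hn : 1 ≤ n)
    (u : E → Measure E → ENNReal) (hu : Measurable (Function.uncurry u))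
    (F : Measure E → ENNReal) (hF : Measurable F) :
    ∫⁻ ξ, F ξ * (∫⁻ y, u y ξ ∂ξ) ^ n ∂μ =
      ∑ k ∈ Finset.Icc 1 n,
        ∑ P ∈ Finset.univ.filter
            (fun P : Finpartition (Finset.univ : Finset (Fin n)) => P.parts.card = k),
          ∫⁻ ξ, ∫⁻ x : Fin P.parts.card → E,
            F (ξ + ∑ l, Measure.dirac (x l)) *
              (∏ l : Fin P.parts.card,
                u (x l) (ξ + ∑ l', Measure.dirac (x l')) ^ (blockOf P l).card) *
              chat c x ξ
            ∂(Measure.pi fun _ => lam) ∂μ := by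
  have hn0 : n ≠ 0 := Nat.one_le_iff_ne_zero.1 hn
  have : NeZero n := ⟨hn0⟩
  rw [Finset.sum_fiberwise_of_maps_to fun P _ => Finset.mem_Icc.2
    ⟨Finset.card_pos.2 (P.parts_nonempty Finset.univ_nonempty.ne_empty),
      by simpa using P.card_parts_le_card⟩]
  let v : E × Measure E → ENNReal := fun p => F p.2 ^ (n : ℝ)⁻¹ * u p.1 p.2
  have hv : Measurable v := ((hF.comp measurable_snd).pow_const _).mul hu
  have hFp (ξ : Measure E) : (F ξ ^ (n : ℝ)⁻¹) ^ n = F ξ := by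
    rw [← ENNReal.rpow_natCast, ENNReal.rpow_inv_rpow (Nat.cast_ne_zero.2 hn0)]
  have hvn (ξ : Measure E) : (∫⁻ y, v (y, ξ) ∂ξ) ^ n = F ξ * (∫⁻ y, u y ξ ∂ξ) ^ n := by
    have huξ : Measurable fun y => u y ξ := hu.comp measurable_prodMk_right
    simp only [v]
    rw [lintegral_const_mul _ huξ, mul_pow, hFp]
  simp only [← hvn]
  rw [lintegral_pow_lowerDensity v hn0,
    lintegral_lowerDensity_pow hc (isCampbell_campbell hc hGNZ) hv]
  refine Finset.sum_congr rfl fun P _ => lintegral_congr fun ξ => lintegral_congr fun x => ?_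
  simp only [tupleIntegrand, v, Pi.one_apply, one_mul, mul_pow, Finset.prod_mul_distrib,
    Finset.prod_pow_eq_pow_sum, sum_card_blockOf, hFp]
end

section
/- For every n ≥ 1, every measurable deterministic function v : E → [0,∞], and every measurable F : X → [0,∞], one has ∫ F(ξ) (∫ v(y) ξ(dy))^n μ(dξ) = ∑_{k=1}^n ∑_{𝒫 = {P_1,…,P_k} ∈ 𝒯_n^k} ∫_{E^k} v(x_1)^{|P_1|} ⋯ v(x_k)^{|P_k|} · (∫_X F(ξ+Δ) ĉ((x_1,…,x_k), ξ) μ(dξ)) λ(dx_1)⋯λ(dx_k), where Δ = δ_{x_1} + ⋯ + δ_{x_k} and |P_l| is the cardinality of the block P_l. -/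
open MeasureTheory Finset

namespace PapangelouMoment

universe u

/-- The iterated integral `∫ ⋯ ∫ ∏ v(x_l)^{m_l} F(ξ + Δ) ĉ(x, ξ)`, peeling off the exponents
from the last particle to the first. -/
noncomputable def iteratedMoment {E : Type*} [MeasurableSpace E] (lam : Measure E)
    (μ : Measure (Measure E)) (c : E → Measure E → ENNReal) (v : E → ENNReal) :
    List ℕ → (Measure E → ENNReal) → ENNReal
  | [], F => ∫⁻ ξ, F ξ ∂μ
  | a :: L, F => ∫⁻ x, v x ^ a *
      iteratedMoment lam μ c v L (fun ξ => F (ξ + Measure.dirac x) * c x ξ) ∂lam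

/-- The polynomial in the occupation numbers `s` of the level sets of a simple function which
represents its factorial moments, with truncated subtraction. -/
noncomputable def occupationPoly (R : Finset ENNReal) : List ℕ → (ENNReal → ENNReal) → ENNReal
  | [], _ => 1
  | a :: L, s => ∑ i ∈ R, i ^ a * s i * occupationPoly R L (s - Pi.single i 1)

theorem occupationPoly_swap (R : Finset ENNReal) (a b : ℕ) (L : List ℕ)
    (s : ENNReal → ENNReal) :
    occupationPoly R (a :: b :: L) s = occupationPoly R (b :: a :: L) s := by
  simp only [occupationPoly, Finset.mul_sum]
  rw [Finset.sum_comm]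
  refine Finset.sum_congr rfl fun i _ => Finset.sum_congr rfl fun j _ => ?_
  rw [tsub_right_comm]
  by_cases h : i = j
  · subst h; ring
  · simp only [Pi.sub_apply, Pi.single_eq_of_ne h, Pi.single_eq_of_ne (Ne.symm h), tsub_zero]
    ring

theorem occupationPoly_perm (R : Finset ENNReal) {L L' : List ℕ} (h : L.Perm L') :
    occupationPoly R L = occupationPoly R L' := by
  induction h with
  | nil => rfl
  | cons a _ ih => funext s; simp only [occupationPoly, ih]
  | swap a b L => funext s; exact occupationPoly_swap R _ _ L s
  | trans _ _ ih₁ ih₂ => exact ih₁.trans ih₂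

theorem measurable_occupationPoly (R : Finset ENNReal) (L : List ℕ) :
    Measurable (occupationPoly R L) := by
  induction L with
  | nil => exact measurable_const
  | cons a L ih =>
    change Measurable fun s : ENNReal → ENNReal => ∑ i ∈ R, i ^ a * s i * occupationPoly R L (s - Pi.single i 1)
    refine Finset.measurable_sum _ fun i _ => ?_
    refine ((measurable_pi_apply i).const_mul _).mul (ih.comp ?_)
    exact measurable_pi_lambda _ fun j => (measurable_pi_apply j).sub_const _

theorem measurable_add_dirac {E : Type*} [MeasurableSpace E] :
    Measurable (fun p : E × Measure E => p.2 + Measure.dirac p.1) :=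
  measurable_snd.add (Measure.measurable_dirac.comp measurable_fst)

variable {E : Type*} [MeasurableSpace E] {lam : Measure E} {μ : Measure (Measure E)}
  {c : E → Measure E → ENNReal}

theorem measurable_shift (hc : Measurable (Function.uncurry c)) {α : Type*} [MeasurableSpace α]
    {G : α → Measure E → ENNReal} (hG : Measurable (Function.uncurry G)) :
    Measurable (Function.uncurry
      fun (p : α × E) (ξ : Measure E) => G p.1 (ξ + Measure.dirac p.2) * c p.2 ξ) := by
  have h₁ : Measurable fun q : (α × E) × Measure E => (q.1.2, q.2) := by fun_prop
  have h₂ : Measurable fun q : (α × E) × Measure E => q.1.1 := by fun_prop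
  exact (hG.comp (h₂.prodMk (measurable_add_dirac.comp h₁))).mul (hc.comp h₁)

theorem measurable_shift_apply (hc : Measurable (Function.uncurry c))
    {F : Measure E → ENNReal} (hF : Measurable F) :
    Measurable (Function.uncurry
      fun (x : E) (ξ : Measure E) => F (ξ + Measure.dirac x) * c x ξ) :=
  (hF.comp measurable_add_dirac).mul hc

theorem measurable_iteratedMoment {E : Type u} [MeasurableSpace E] {lam : Measure E}
    {μ : Measure (Measure E)} {c : E → Measure E → ENNReal} [SFinite lam] [SFinite μ]
    (hc : Measurable (Function.uncurry c)) {v : E → ENNReal} (hv : Measurable v) (L : List ℕ)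
    {α : Type u} [MeasurableSpace α] {G : α → Measure E → ENNReal}
    (hG : Measurable (Function.uncurry G)) :
    Measurable fun t => iteratedMoment lam μ c v L (G t) := by
  induction L generalizing α with
  | nil => exact hG.lintegral_prod_right
  | cons a L ih =>
    exact (((hv.comp measurable_snd).pow_const a).mul
      (ih (measurable_shift hc hG))).lintegral_prod_right'

/-- The Georgii–Nguyen–Zessin identity with the order of integration exchanged. -/
theorem lintegral_gnz_swap [SFinite lam] [SFinite μ] (hc : Measurable (Function.uncurry c))
    (hGNZ : ∀ w : E → Measure E → ENNReal, Measurable (Function.uncurry w) →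
      ∫⁻ ξ, (∫⁻ x, w x ξ ∂ξ) ∂μ
        = ∫⁻ ξ, ∫⁻ x, w x (ξ + Measure.dirac x) * c x ξ ∂lam ∂μ)
    {w : E → Measure E → ENNReal} (hw : Measurable (Function.uncurry w)) :
    ∫⁻ ξ, (∫⁻ x, w x ξ ∂ξ) ∂μ
      = ∫⁻ x, ∫⁻ ξ, w x (ξ + Measure.dirac x) * c x ξ ∂μ ∂lam := by
  rw [hGNZ w hw, lintegral_lintegral_swap]
  have h : Measurable fun q : Measure E × E => (q.2, q.1) := by fun_prop
  have h₂ : Measurable fun q : Measure E × E => q.2 := by fun_prop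
  exact ((hw.comp (h₂.prodMk (measurable_add_dirac.comp h))).mul (hc.comp h)).aemeasurable

theorem iteratedMoment_simpleFunc [SFinite lam] [SFinite μ] (hc : Measurable (Function.uncurry c))
    (hGNZ : ∀ w : E → Measure E → ENNReal, Measurable (Function.uncurry w) →
      ∫⁻ ξ, (∫⁻ x, w x ξ ∂ξ) ∂μ
        = ∫⁻ ξ, ∫⁻ x, w x (ξ + Measure.dirac x) * c x ξ ∂lam ∂μ)
    (v : SimpleFunc E ENNReal) (L : List ℕ) {F : Measure E → ENNReal} (hF : Measurable F) :
    iteratedMoment lam μ c v L F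
      = ∫⁻ ξ, F ξ * occupationPoly v.range L (fun i => ξ (v ⁻¹' {i})) ∂μ := by
  induction L generalizing F with
  | nil => simp [iteratedMoment, occupationPoly]
  | cons a L ih =>
    have hlevel : ∀ i : ENNReal, MeasurableSet (v ⁻¹' {i}) := fun i => v.measurableSet_preimage _
    let w : E → Measure E → ENNReal := fun x ξ =>
      v x ^ a * F ξ * occupationPoly v.range L ((fun i => ξ (v ⁻¹' {i})) - Pi.single (v x) 1)
    have hw : Measurable (Function.uncurry w) := by
      refine (((v.measurable.comp measurable_fst).pow_const a).mul (hF.comp measurable_snd)).mul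
        ((measurable_occupationPoly _ L).comp (measurable_pi_lambda _ fun i => ?_))
      refine ((Measure.measurable_coe (hlevel i)).comp measurable_snd).sub ?_
      have : Measurable fun x => (Pi.single (v x) 1 : ENNReal → ENNReal) i := by
        have : (fun x => (Pi.single (v x) 1 : ENNReal → ENNReal) i)
            = (v ⁻¹' {i}).indicator 1 := by
          funext x
          by_cases h : v x = i
          · subst h; simp [Set.indicator]
          · simp [Set.indicator, h]
        rw [this]
        exact measurable_one.indicator (hlevel i)
      exact this.comp measurable_fst
    have hinner : ∀ ξ : Measure E, ∫⁻ x, w x ξ ∂ξ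
        = F ξ * occupationPoly v.range (a :: L) (fun i => ξ (v ⁻¹' {i})) := by
      intro ξ
      let g : ENNReal → ENNReal := fun r =>
        r ^ a * F ξ * occupationPoly v.range L ((fun i => ξ (v ⁻¹' {i})) - Pi.single r 1)
      have := SimpleFunc.lintegral_eq_lintegral (v.map g) ξ
      rw [SimpleFunc.map_lintegral] at this
      refine Eq.trans this ?_
      simp only [occupationPoly, Finset.mul_sum, g]
      exact Finset.sum_congr rfl fun i _ => by ring
    rw [← lintegral_congr hinner, lintegral_gnz_swap hc hGNZ hw]
    unfold iteratedMoment
    refine lintegral_congr fun x => ?_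
    have hFx : Measurable fun ξ : Measure E => F (ξ + Measure.dirac x) * c x ξ :=
      (measurable_shift_apply hc hF).of_uncurry_left
    have hcount : Measurable fun (ξ : Measure E) (i : ENNReal) => ξ (v ⁻¹' {i}) :=
      measurable_pi_lambda _ fun i => Measure.measurable_coe (hlevel i)
    rw [ih hFx]
    have hprod : Measurable fun ξ : Measure E => F (ξ + Measure.dirac x) * c x ξ *
        occupationPoly v.range L (fun i => ξ (v ⁻¹' {i})) :=
      hFx.mul ((measurable_occupationPoly _ L).comp hcount)
    rw [← lintegral_const_mul _ hprod]
    refine lintegral_congr fun ξ => ?_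
    have hs : (fun i => (ξ + Measure.dirac x) (v ⁻¹' {i})) - Pi.single (v x) 1
        = fun i => ξ (v ⁻¹' {i}) := by
      funext i
      rw [Pi.sub_apply, Measure.add_apply, Measure.dirac_apply' _ (hlevel i)]
      by_cases h : v x = i
      · subst h; simp
      · simp [Set.indicator, h]
    simp only [w, hs]
    ring

theorem iSup_mul_iSup_of_monotone {f g : ℕ → ENNReal} (hf : Monotone f) (hg : Monotone g) :
    (⨆ n, f n) * ⨆ n, g n = ⨆ n, f n * g n := by
  refine le_antisymm ?_ (iSup_le fun n => mul_le_mul' (le_iSup f n) (le_iSup g n))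
  simp only [ENNReal.iSup_mul, ENNReal.mul_iSup]
  exact iSup_le fun i => iSup_le fun j => le_iSup_of_le (max i j)
    (mul_le_mul' (hf (le_max_right i j)) (hg (le_max_left i j)))

theorem iteratedMoment_mono {v w : E → ENNReal} (h : v ≤ w) (L : List ℕ)
    (F : Measure E → ENNReal) :
    iteratedMoment lam μ c v L F ≤ iteratedMoment lam μ c w L F := by
  induction L generalizing F with
  | nil => exact le_rfl
  | cons a L ih =>
    exact lintegral_mono fun x => mul_le_mul' (pow_le_pow_left' (h x) a) (ih _)

theorem iteratedMoment_iSup [SFinite lam] [SFinite μ] (hc : Measurable (Function.uncurry c))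
    {v : ℕ → E → ENNReal} (hv : ∀ n, Measurable (v n)) (hmono : Monotone v) (L : List ℕ)
    {F : Measure E → ENNReal} (hF : Measurable F) :
    iteratedMoment lam μ c (fun x => ⨆ n, v n x) L F = ⨆ n, iteratedMoment lam μ c (v n) L F := by
  induction L generalizing F with
  | nil => simp [iteratedMoment]
  | cons a L ih =>
    unfold iteratedMoment
    have hpow (x : E) : Monotone fun n => v n x ^ a :=
      fun i j hij => pow_le_pow_left' (hmono hij x) a
    rw [← lintegral_iSup]
    · refine lintegral_congr fun x => ?_
      rw [ih (measurable_shift_apply hc hF).of_uncurry_left, ENNReal.iSup_pow,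
        iSup_mul_iSup_of_monotone (hpow x)]
      exact fun i j hij => iteratedMoment_mono (hmono hij) _ _
    · exact fun n => ((hv n).pow_const a).mul
        (measurable_iteratedMoment hc (hv n) L (measurable_shift_apply hc hF))
    · exact fun i j hij x => mul_le_mul' (hpow x hij) (iteratedMoment_mono (hmono hij) _ _)

theorem iteratedMoment_perm [SFinite lam] [SFinite μ] (hc : Measurable (Function.uncurry c))
    (hGNZ : ∀ w : E → Measure E → ENNReal, Measurable (Function.uncurry w) →
      ∫⁻ ξ, (∫⁻ x, w x ξ ∂ξ) ∂μ
        = ∫⁻ ξ, ∫⁻ x, w x (ξ + Measure.dirac x) * c x ξ ∂lam ∂μ)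
    {v : E → ENNReal} (hv : Measurable v) {L L' : List ℕ} (h : L.Perm L')
    {F : Measure E → ENNReal} (hF : Measurable F) :
    iteratedMoment lam μ c v L F = iteratedMoment lam μ c v L' F := by
  have hsup : v = fun x => ⨆ n, SimpleFunc.eapprox v n x :=
    funext fun x => (SimpleFunc.iSup_eapprox_apply hv x).symm
  have hmono : Monotone fun n => (SimpleFunc.eapprox v n : E → ENNReal) :=
    SimpleFunc.monotone_eapprox v
  have key (M : List ℕ) := iteratedMoment_iSup (lam := lam) (μ := μ) hc
    (fun n => (SimpleFunc.eapprox v n).measurable) hmono M hF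
  rw [hsup, key L, key L']
  refine iSup_congr fun n => ?_
  rw [iteratedMoment_simpleFunc hc hGNZ _ L hF, iteratedMoment_simpleFunc hc hGNZ _ L' hF,
    occupationPoly_perm _ h]


theorem chat_snoc {k : ℕ} (x : Fin k → E) (y : E) (ξ : Measure E) :
    chat c (Fin.snoc (α := fun _ => E) x y) ξ
      = chat c x ξ * c y (ξ + ∑ l, Measure.dirac (x l)) := by
  unfold chat
  rw [Fin.prod_univ_castSucc]
  simp only [Finset.sum_filter, Fin.sum_univ_castSucc, Fin.snoc_castSucc, Fin.snoc_last,
    Fin.castSucc_lt_castSucc_iff, Fin.castSucc_lt_last, if_true, lt_irrefl, if_false, add_zero,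
    (Fin.castSucc_lt_last _).not_gt]

theorem measurable_add_sum_dirac {k : ℕ} (s : Finset (Fin k)) :
    Measurable fun p : (Fin k → E) × Measure E => p.2 + ∑ l ∈ s, Measure.dirac (p.1 l) :=
  measurable_snd.add <| Finset.measurable_sum _ fun l _ =>
    Measure.measurable_dirac.comp ((measurable_pi_apply l).comp measurable_fst)

theorem measurable_chat (hc : Measurable (Function.uncurry c)) (k : ℕ) :
    Measurable fun p : (Fin k → E) × Measure E => chat c p.1 p.2 :=
  Finset.measurable_prod _ fun l _ =>
    hc.comp (((measurable_pi_apply l).comp measurable_fst).prodMk (measurable_add_sum_dirac _))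

theorem lintegral_pi_eq_iteratedMoment [SigmaFinite lam] [SFinite μ]
    (hc : Measurable (Function.uncurry c)) {v : E → ENNReal} (hv : Measurable v) {k : ℕ}
    (m : Fin k → ℕ) {F : Measure E → ENNReal} (hF : Measurable F) :
    ∫⁻ x : Fin k → E, (∏ l, v (x l) ^ m l) *
        ∫⁻ ξ, F (ξ + ∑ l, Measure.dirac (x l)) * chat c x ξ ∂μ ∂(Measure.pi fun _ => lam)
      = iteratedMoment lam μ c v (List.ofFn m).reverse F := by
  induction k generalizing F with
  | zero => simp [iteratedMoment, lintegral_unique, chat]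
  | succ k ih =>
    have hmeas : Measurable fun x : Fin (k + 1) → E => (∏ l, v (x l) ^ m l) *
        ∫⁻ ξ, F (ξ + ∑ l, Measure.dirac (x l)) * chat c x ξ ∂μ := by
      refine (Finset.measurable_prod _ fun l _ =>
        (hv.comp (measurable_pi_apply l)).pow_const _).mul ?_
      exact ((hF.comp (measurable_add_sum_dirac _)).mul
        (measurable_chat hc _)).lintegral_prod_right'
    have hmp := (measurePreserving_piFinSuccAbove (fun _ : Fin (k + 1) => lam) (Fin.last k)).symm
    rw [← hmp.lintegral_comp hmeas, lintegral_prod]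
    swap
    · exact (hmeas.comp hmp.measurable).aemeasurable
    rw [List.ofFn_succ', List.concat_eq_append, List.reverse_append]
    refine lintegral_congr fun y => ?_
    simp only [List.append_eq, List.nil_append]
    rw [← ih _ (measurable_shift_apply hc hF).of_uncurry_left, ← lintegral_const_mul]
    · refine lintegral_congr fun x => ?_
      have hx : (MeasurableEquiv.piFinSuccAbove (fun _ => E) (Fin.last k)).symm (y, x)
          = Fin.snoc (α := fun _ => E) x y :=
        Fin.insertNth_last' y x
      simp only [hx, chat_snoc, Fin.prod_univ_castSucc, Fin.sum_univ_castSucc, Fin.snoc_castSucc,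
        Fin.snoc_last]
      rw [mul_comm (∏ l, _) (v y ^ _), mul_assoc]
      congr 2
      refine lintegral_congr fun ξ => ?_
      rw [add_assoc]
      ring
    · refine (Finset.measurable_prod _ fun l _ =>
        (hv.comp (measurable_pi_apply l)).pow_const _).mul ?_
      exact (((measurable_shift_apply hc hF).of_uncurry_left.comp
        (measurable_add_sum_dirac _)).mul (measurable_chat hc _)).lintegral_prod_right'

/-- A partition of `insert a s` is given by the block containing `a` and a partition of the
remaining elements. -/
theorem sum_finpartition_insert {α M : Type*} [DecidableEq α] [AddCommMonoid M] {a : α}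
    {s : Finset α} (ha : a ∉ s) (g : Finset (Finset α) → M) :
    ∑ P : Finpartition (insert a s), g P.parts
      = ∑ t ∈ s.powerset, ∑ Q : Finpartition (s \ t), g (insert (insert a t) Q.parts) := by
  have hout (t : Finset α) (Q : Finpartition (s \ t)) {b : Finset α} (hb : b ∈ Q.parts) :
      a ∉ b := fun hab => ha (Finset.mem_sdiff.1 (Q.subset hb hab)).1
  symm
  rw [Finset.sum_sigma']
  refine Finset.sum_bij (fun p hp => p.2.extend (b := insert a p.1)
    (Finset.insert_ne_empty _ _) ?_ ?_) (fun _ _ => Finset.mem_univ _) ?_ ?_ fun _ _ => rfl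
  · rw [Finset.disjoint_insert_right]
    exact ⟨fun h => ha (Finset.mem_sdiff.1 h).1, Finset.sdiff_disjoint⟩
  · have hsub : p.1 ⊆ s := Finset.mem_powerset.1 (Finset.mem_sigma.1 hp).1
    rw [Finset.sup_eq_union, Finset.union_insert, Finset.sdiff_union_of_subset hsub]
  · rintro ⟨t, Q⟩ h ⟨t', Q'⟩ h' heq
    have hparts : insert (insert a t) Q.parts = insert (insert a t') Q'.parts :=
      congrArg Finpartition.parts heq
    have hat {u : Finset α} (hu : u ∈ s.powerset) : a ∉ u :=
      fun hau => ha (Finset.mem_powerset.1 hu hau)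
    have htt : t = t' := by
      have hmem : insert a t ∈ insert (insert a t') Q'.parts :=
        hparts ▸ Finset.mem_insert_self _ _
      rcases Finset.mem_insert.1 hmem with hb | hb
      · exact (Finset.erase_insert (hat (Finset.mem_sigma.1 h).1)).symm.trans
          ((congrArg (Finset.erase · a) hb).trans
            (Finset.erase_insert (hat (Finset.mem_sigma.1 h').1)))
      · exact absurd (Finset.mem_insert_self a t) (hout _ Q' hb)
    subst htt
    have hQ : Q.parts = Q'.parts := by
      rw [← Finset.erase_insert fun hb => hout _ Q hb (Finset.mem_insert_self a t), hparts,
        Finset.erase_insert fun hb => hout _ Q' hb (Finset.mem_insert_self a t)]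
    rw [Finpartition.ext hQ]
  · intro P _
    have haP : a ∈ P.part a := P.mem_part_self.2 (Finset.mem_insert_self a s)
    have hPa : P.part a ∈ P.parts := P.part_mem.2 (Finset.mem_insert_self a s)
    have hsd : insert a s \ P.part a = s \ (P.part a).erase a := by
      ext x
      by_cases hx : x = a
      · subst hx; simp [haP, ha]
      · simp [hx]
    have hsub : (P.part a).erase a ⊆ s := fun x hx =>
      (Finset.mem_insert.1 (P.part_subset a (Finset.mem_of_mem_erase hx))).resolve_left
        (Finset.ne_of_mem_erase hx)
    refine ⟨⟨(P.part a).erase a, (P.avoid (P.part a)).copy hsd⟩, by simpa using hsub, ?_⟩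
    ext b
    change b ∈ insert (insert a ((P.part a).erase a)) (P.avoid (P.part a)).parts ↔ b ∈ P.parts
    rw [Finset.insert_erase haP, Finset.mem_insert, Finpartition.mem_avoid]
    have hdisj {d : Finset α} (hd : d ∈ P.parts) (hne : d ≠ P.part a) : d \ P.part a = d :=
      Finset.sdiff_eq_self_of_disjoint (P.disjoint hd hPa hne)
    constructor
    · rintro (rfl | ⟨d, hd, hle, rfl⟩)
      · exact hPa
      · rwa [hdisj hd fun h => hle h.le]
    · intro hb
      by_cases hba : b = P.part a
      · exact Or.inl hba
      · refine Or.inr ⟨b, hb, fun hle => P.ne_empty hb ?_, hdisj hb hba⟩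
        rw [← hdisj hb hba]
        exact Finset.sdiff_eq_empty_iff_subset.2 hle

theorem lintegral_mul_pow_card_eq_sum [SFinite lam] [SFinite μ]
    (hc : Measurable (Function.uncurry c))
    (hGNZ : ∀ w : E → Measure E → ENNReal, Measurable (Function.uncurry w) →
      ∫⁻ ξ, (∫⁻ x, w x ξ ∂ξ) ∂μ
        = ∫⁻ ξ, ∫⁻ x, w x (ξ + Measure.dirac x) * c x ξ ∂lam ∂μ)
    {v : E → ENNReal} (hv : Measurable v) {α : Type*} [DecidableEq α] (s : Finset α)
    {F : Measure E → ENNReal} (hF : Measurable F) :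
    ∫⁻ ξ, F ξ * (∫⁻ y, v y ∂ξ) ^ s.card ∂μ
      = ∑ P : Finpartition s, iteratedMoment lam μ c v (P.parts.toList.map Finset.card) F := by
  induction s using Finset.strongInduction generalizing F with
  | H s ih =>
  rcases s.eq_empty_or_nonempty with rfl | ⟨a, has⟩
  · have huniv : (Finset.univ : Finset (Finpartition (∅ : Finset α)))
        = {Finpartition.empty (Finset α)} := by
      ext P
      simpa using Subsingleton.elim (α := Finpartition (⊥ : Finset α)) P _
    rw [huniv, Finset.sum_singleton]
    simp [iteratedMoment, Finpartition.empty]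
  obtain ⟨s, ha, rfl⟩ : ∃ u, a ∉ u ∧ insert a u = s :=
    ⟨s.erase a, Finset.notMem_erase a s, Finset.insert_erase has⟩
  have hS : Measurable fun ξ : Measure E => ∫⁻ y, v y ∂ξ := Measure.measurable_lintegral hv
  let w : E → Measure E → ENNReal := fun x ξ => F ξ * (∫⁻ y, v y ∂ξ) ^ s.card * v x
  have hw : Measurable (Function.uncurry w) :=
    ((hF.mul (hS.pow_const _)).comp measurable_snd).mul (hv.comp measurable_fst)
  have hinner (ξ : Measure E) :
      ∫⁻ x, w x ξ ∂ξ = F ξ * (∫⁻ y, v y ∂ξ) ^ (insert a s).card := by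
    rw [lintegral_const_mul _ hv, Finset.card_insert_of_notMem ha, pow_succ, mul_assoc]
  rw [← lintegral_congr hinner, lintegral_gnz_swap hc hGNZ hw, sum_finpartition_insert ha
    fun p => iteratedMoment lam μ c v (p.toList.map Finset.card) F]
  have hG := measurable_shift_apply hc hF
  have hterm (x : E) : ∫⁻ ξ, w x (ξ + Measure.dirac x) * c x ξ ∂μ
      = ∑ t ∈ s.powerset, ∑ Q : Finpartition (s \ t), v x ^ (insert a t).card *
        iteratedMoment lam μ c v (Q.parts.toList.map Finset.card)
          (fun ξ => F (ξ + Measure.dirac x) * c x ξ) := by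
    have hexp (ξ : Measure E) : w x (ξ + Measure.dirac x) * c x ξ
        = ∑ t ∈ s.powerset, v x ^ (insert a t).card *
          (F (ξ + Measure.dirac x) * c x ξ * (∫⁻ y, v y ∂ξ) ^ (s \ t).card) := by
      simp only [w]
      rw [lintegral_add_measure, lintegral_dirac' _ hv, add_comm (∫⁻ y, v y ∂ξ),
        ← Finset.sum_pow_mul_eq_add_pow, Finset.mul_sum, Finset.sum_mul, Finset.sum_mul]
      refine Finset.sum_congr rfl fun t ht => ?_
      have hts := Finset.mem_powerset.1 ht
      rw [Finset.card_insert_of_notMem fun h => ha (hts h), Finset.card_sdiff_of_subset hts]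
      ring
    have hGx := hG.of_uncurry_left (x := x)
    have hm (n : ℕ) : Measurable fun ξ : Measure E =>
        F (ξ + Measure.dirac x) * c x ξ * (∫⁻ y, v y ∂ξ) ^ n := hGx.mul (hS.pow_const n)
    rw [lintegral_congr hexp, lintegral_finsetSum _ fun t _ => (hm _).const_mul _]
    refine Finset.sum_congr rfl fun t ht => ?_
    rw [lintegral_const_mul _ (hm _), ih (s \ t) ?_ hGx, Finset.mul_sum]
    exact Finset.sdiff_subset.trans_ssubset (Finset.ssubset_insert ha)
  have hmeas {β : Finset α} (P : Finpartition β) (n : ℕ) : Measurable fun x =>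
      v x ^ n * iteratedMoment lam μ c v (P.parts.toList.map Finset.card)
        (fun ξ => F (ξ + Measure.dirac x) * c x ξ) :=
    (hv.pow_const n).mul (measurable_iteratedMoment hc hv _ hG)
  rw [lintegral_congr hterm, lintegral_finsetSum _ fun t _ =>
    Finset.measurable_sum _ fun Q _ => hmeas Q _]
  refine Finset.sum_congr rfl fun t ht => ?_
  rw [lintegral_finsetSum _ fun Q _ => hmeas Q _]
  refine Finset.sum_congr rfl fun Q _ => ?_
  have hnot : insert a t ∉ Q.parts := fun h =>
    ha (Finset.mem_sdiff.1 (Q.subset h (Finset.mem_insert_self a t))).1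
  exact iteratedMoment_perm (L := (insert a t).card :: Q.parts.toList.map Finset.card) hc hGNZ hv
    ((Finset.toList_insert hnot).map Finset.card).symm hF

theorem ofFn_card_blockOf_perm {n : ℕ} (P : Finpartition (Finset.univ : Finset (Fin n))) :
    (List.ofFn fun l => (blockOf P l).card).Perm (P.parts.toList.map Finset.card) := by
  rw [← Multiset.coe_eq_coe, ← Fin.univ_val_map, ← Multiset.map_coe, Finset.coe_toList]
  have h : P.parts.val = (Finset.univ : Finset (Fin P.parts.card)).val.map (blockOf P) := by
    have he := congrArg Finset.val (Finset.map_univ_equiv P.parts.equivFin.symm)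
    rw [Finset.map_val] at he
    have hv := congrArg (Multiset.map Subtype.val) he
    rw [Multiset.map_map] at hv
    exact (Finset.attach_val P.parts ▸ Multiset.attach_map_val P.parts.val).symm.trans hv.symm
  conv_rhs => rw [h, Multiset.map_map]
  rfl

end PapangelouMoment

open PapangelouMoment in
/-- Moment formula for a deterministic integrand (Corollary 3.4):
`∫ F(ξ) (∫ v(y) ξ(dy))^n μ(dξ)
  = ∑_{k=1}^n ∑_{𝒫 ∈ 𝒯_n^k} ∫_{E^k} v(x_1)^{|P_1|}⋯v(x_k)^{|P_k|}
      (∫_X F(ξ+Δ) ĉ(x,ξ) μ(dξ)) λ^k(dx)`. -/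
theorem moment_formula_deterministic
    {E : Type*} [MeasurableSpace E] (lam : Measure E) [SigmaFinite lam]
    (μ : Measure (Measure E)) [IsProbabilityMeasure μ]
    (c : E → Measure E → ENNReal) (hc : Measurable (Function.uncurry c))
    (hGNZ : ∀ w : E → Measure E → ENNReal, Measurable (Function.uncurry w) →
      ∫⁻ ξ, (∫⁻ x, w x ξ ∂ξ) ∂μ
        = ∫⁻ ξ, ∫⁻ x, w x (ξ + Measure.dirac x) * c x ξ ∂lam ∂μ)
    (n : ℕ) (hn : 1 ≤ n)
    (v : E → ENNReal) (hv : Measurable v)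
    (F : Measure E → ENNReal) (hF : Measurable F) :
    ∫⁻ ξ, F ξ * (∫⁻ y, v y ∂ξ) ^ n ∂μ =
      ∑ k ∈ Finset.Icc 1 n,
        ∑ P ∈ Finset.univ.filter
            (fun P : Finpartition (Finset.univ : Finset (Fin n)) => P.parts.card = k),
          ∫⁻ x : Fin P.parts.card → E,
            (∏ l : Fin P.parts.card, v (x l) ^ (blockOf P l).card) *
              ∫⁻ ξ, F (ξ + ∑ l, Measure.dirac (x l)) * chat c x ξ ∂μ
            ∂(Measure.pi fun _ => lam) := by
  have hn' : (Finset.univ : Finset (Fin n)).card = n := Finset.card_fin n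
  have hmaps : ∀ P ∈ (Finset.univ : Finset (Finpartition (Finset.univ : Finset (Fin n)))),
      P.parts.card ∈ Finset.Icc 1 n := by
    intro P _
    have hne : (Finset.univ : Finset (Fin n)) ≠ ⊥ := by
      rw [Finset.bot_eq_empty, ← Finset.nonempty_iff_ne_empty, ← Finset.card_pos, hn']
      exact hn
    exact Finset.mem_Icc.2
      ⟨Finset.card_pos.2 (P.parts_nonempty hne), P.card_parts_le_card.trans hn'.le⟩
  rw [Finset.sum_fiberwise_of_maps_to hmaps]
  have key := lintegral_mul_pow_card_eq_sum hc hGNZ hv (Finset.univ : Finset (Fin n)) hF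
  rw [hn'] at key
  rw [key]
  refine Finset.sum_congr rfl fun P _ => ?_
  rw [lintegral_pi_eq_iteratedMoment hc hv _ hF]
  exact iteratedMoment_perm hc hGNZ hv
    ((List.reverse_perm _).trans (ofFn_card_blockOf_perm P)).symm hF
end
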